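/- Let G be a simple graph on a finite vertex type α in which every vertex has even degree and whose maximum degree equals 4. Then G admits a cycle odd-cover of size at most 3: there exists a family of at most three cycles in the complete graph on α whose symmetric difference equals G. -/

import Mathlib

/-- The degree of a vertex, as the cardinality of its neighbor set. -/
noncomputable def degS {α : Type*} (G : SimpleGraph α) (v : α) : ℕ := (G.neighborSet v).ncard

/-- A polycycle: every vertex has degree 0 or 2 (every component is a cycle). -/
def IsPolycycle {α : Type*} (G : SimpleGraph α) : Prop :=
  ∀ v, degS G v = 0 ∨ degS G v = 2

/-- A cycle graph: a nonempty connected graph in which every non-isolated vertex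
has degree 2. -/
def IsCycleGraph {α : Type*} (G : SimpleGraph α) : Prop :=
  G ≠ ⊥ ∧ (∀ v, degS G v = 0 ∨ degS G v = 2) ∧
    ∀ u v, 0 < degS G u → 0 < degS G v → G.Reachable u v

/-- A path graph: a graph whose edge set forms a nontrivial path. -/
def IsPathGraph {α : Type*} (G : SimpleGraph α) : Prop :=
  G ≠ ⊥ ∧ G.IsAcyclic ∧ (∀ v, degS G v ≤ 2) ∧
    ∀ u v, 0 < degS G u → 0 < degS G v → G.Reachable u v

/-- A linear forest: an acyclic graph of maximum degree at most 2. -/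
def IsLinearForest {α : Type*} (G : SimpleGraph α) : Prop :=
  G.IsAcyclic ∧ ∀ v, degS G v ≤ 2

/-- The symmetric difference of a family (list) of graphs: an edge belongs to it
iff it belongs to an odd number of members. -/
def listSymmDiff {α : Type*} (L : List (SimpleGraph α)) : SimpleGraph α :=
  L.foldr symmDiff ⊥

section Degrees

variable {α : Type*}

lemma Ne.edge_adj' {s t : α} (h : s ≠ t) : (SimpleGraph.edge s t).Adj s t := by
  rw [SimpleGraph.edge_adj]; exact ⟨Or.inl ⟨rfl, rfl⟩, h⟩

/-- The relation of being joined by a walk in a graph with one more edge. -/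
lemma reachable_sup_edge {F : SimpleGraph α} {s t a b : α}
    (h : (F ⊔ SimpleGraph.edge s t).Reachable a b) :
    F.Reachable a b ∨ (F.Reachable a s ∧ F.Reachable t b) ∨
      (F.Reachable a t ∧ F.Reachable s b) := by
  rw [SimpleGraph.reachable_iff_reflTransGen] at h
  induction h with
  | refl => exact Or.inl (SimpleGraph.Reachable.refl _)
  | @tail c d _ hcd ih =>
    rw [SimpleGraph.sup_adj, SimpleGraph.edge_adj] at hcd
    rcases hcd with hcd | ⟨⟨rfl, rfl⟩ | ⟨rfl, rfl⟩, -⟩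
    · have := hcd.reachable
      rcases ih with h | ⟨h, h'⟩ | ⟨h, h'⟩
      · exact Or.inl (h.trans this)
      · exact Or.inr (Or.inl ⟨h, h'.trans this⟩)
      · exact Or.inr (Or.inr ⟨h, h'.trans this⟩)
    · rcases ih with h | ⟨h, h'⟩ | ⟨h, h'⟩
      · exact Or.inr (Or.inl ⟨h, SimpleGraph.Reachable.refl _⟩)
      · exact Or.inr (Or.inl ⟨h, SimpleGraph.Reachable.refl _⟩)
      · exact Or.inl h
    · rcases ih with h | ⟨h, h'⟩ | ⟨h, h'⟩
      · exact Or.inr (Or.inr ⟨h, SimpleGraph.Reachable.refl _⟩)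
      · exact Or.inl h
      · exact Or.inr (Or.inr ⟨h, SimpleGraph.Reachable.refl _⟩)

/-- A set closed under adjacency is closed under reachability. -/
lemma SimpleGraph.Reachable.mem_of_closed {F : SimpleGraph α} {P : α → Prop}
    (hP : ∀ a b, P a → F.Adj a b → P b) {a b : α} (h : F.Reachable a b) (ha : P a) : P b := by
  rw [SimpleGraph.reachable_iff_reflTransGen] at h
  induction h with
  | refl => exact ha
  | tail _ hcd ih => exact hP _ _ ih hcd

lemma SimpleGraph.Reachable.eq_of_isolated {F : SimpleGraph α} {a b : α}
    (h : F.Reachable a b) (ha : ∀ c, ¬ F.Adj a c) : b = a :=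
  h.mem_of_closed (P := fun c => c = a) (fun c d hc hcd => by subst hc; exact (ha _ hcd).elim) rfl

lemma SimpleGraph.Reachable.exists_adj {F : SimpleGraph α} {a b : α}
    (h : F.Reachable a b) (hne : a ≠ b) : ∃ c, F.Adj a c := by
  by_contra! hc
  exact hne (h.eq_of_isolated hc).symm

lemma degS_eq_one {F : SimpleGraph α} {v : α} :
    degS F v = 1 ↔ ∃ a, ∀ w, F.Adj v w ↔ w = a := by
  unfold degS
  simp [Set.ncard_eq_one, Set.ext_iff]

lemma degS_eq_two {F : SimpleGraph α} {v : α} :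
    degS F v = 2 ↔ ∃ a b, a ≠ b ∧ ∀ w, F.Adj v w ↔ w = a ∨ w = b := by
  unfold degS
  simp [Set.ncard_eq_two, Set.ext_iff]

lemma sdiff_edge_sup {F : SimpleGraph α} {s t : α} (h : F.Adj s t) :
    (F \ SimpleGraph.edge s t) ⊔ SimpleGraph.edge s t = F := by
  apply sdiff_sup_cancel
  intro a b hab
  rw [SimpleGraph.edge_adj] at hab
  rcases hab with ⟨⟨rfl, rfl⟩ | ⟨rfl, rfl⟩, -⟩
  · exact h
  · exact h.symm

lemma degS_edge_left {s t : α} (h : s ≠ t) : degS (SimpleGraph.edge s t) s = 1 := by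
  rw [degS_eq_one]
  refine ⟨t, fun w => ?_⟩
  rw [SimpleGraph.edge_adj]
  grind

lemma degS_edge_right {s t : α} (h : s ≠ t) : degS (SimpleGraph.edge s t) t = 1 := by
  rw [degS_eq_one]
  refine ⟨s, fun w => ?_⟩
  rw [SimpleGraph.edge_adj]
  grind

variable [Finite α]

lemma degS_eq_zero {F : SimpleGraph α} {v : α} : degS F v = 0 ↔ ∀ w, ¬ F.Adj v w := by
  unfold degS
  rw [Set.ncard_eq_zero, Set.eq_empty_iff_forall_notMem]
  rfl

lemma degS_pos {F : SimpleGraph α} {v : α} : 0 < degS F v ↔ ∃ w, F.Adj v w := by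
  rw [Nat.pos_iff_ne_zero, Ne, degS_eq_zero]; push Not; rfl

lemma degS_le_one {F : SimpleGraph α} {v : α} :
    degS F v ≤ 1 ↔ ∀ a b, F.Adj v a → F.Adj v b → a = b := by
  unfold degS
  rw [Set.ncard_le_one]
  simp only [SimpleGraph.mem_neighborSet]
  tauto

lemma degS_mono {F H : SimpleGraph α} (h : F ≤ H) (v : α) : degS F v ≤ degS H v :=
  Set.ncard_le_ncard (fun _ hw => h hw)

lemma degS_bot (v : α) : degS (⊥ : SimpleGraph α) v = 0 := by
  rw [degS_eq_zero]; simp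

lemma degS_sup {F H : SimpleGraph α} (h : ∀ a b, F.Adj a b → ¬ H.Adj a b) (v : α) :
    degS (F ⊔ H) v = degS F v + degS H v := by
  unfold degS
  rw [← Set.ncard_union_eq]
  · rfl
  · rw [Set.disjoint_left]; exact fun w hw hw' => h _ _ hw hw'

lemma degS_sdiff {F H : SimpleGraph α} (h : H ≤ F) (v : α) :
    degS (F \ H) v + degS H v = degS F v := by
  rw [← degS_sup, sdiff_sup_cancel h]
  intro a b hab
  exact (SimpleGraph.sdiff_adj _ _ _ _ |>.1 hab).2

lemma degS_edge_of_ne {s t v : α} (hs : v ≠ s) (ht : v ≠ t) :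
    degS (SimpleGraph.edge s t) v = 0 := by
  rw [degS_eq_zero]
  intro w
  rw [SimpleGraph.edge_adj]
  grind

lemma degS_sup_edge {F : SimpleGraph α} {s t : α} (h : ¬ F.Adj s t) (v : α) :
    degS (F ⊔ SimpleGraph.edge s t) v = degS F v + degS (SimpleGraph.edge s t) v := by
  apply degS_sup
  intro a b hab
  rw [SimpleGraph.edge_adj]
  rintro ⟨⟨rfl, rfl⟩ | ⟨rfl, rfl⟩, -⟩
  · exact h hab
  · exact h hab.symm

lemma degS_sdiff_edge {F : SimpleGraph α} {s t : α} (h : F.Adj s t) (v : α) :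
    degS (F \ SimpleGraph.edge s t) v + degS (SimpleGraph.edge s t) v = degS F v := by
  apply degS_sdiff
  intro a b hab
  rw [SimpleGraph.edge_adj] at hab
  rcases hab with ⟨⟨rfl, rfl⟩ | ⟨rfl, rfl⟩, -⟩
  · exact h
  · exact h.symm

/-- In a graph of maximum degree two, a vertex of degree one is joined to exactly one other
vertex of degree at most one. -/
lemma exists_partner : ∀ (n : ℕ) (F : SimpleGraph α), F.edgeSet.ncard = n →
    (∀ v, degS F v ≤ 2) → ∀ v, degS F v = 1 →
    ∃ w, w ≠ v ∧ degS F w = 1 ∧ F.Reachable v w ∧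
      ∀ w', degS F w' ≤ 1 → F.Reachable v w' → w' = v ∨ w' = w := by
  intro n
  induction n with
  | zero =>
    intro F hF _ v hv
    rw [Set.ncard_eq_zero, SimpleGraph.edgeSet_eq_empty] at hF
    subst hF
    simp [degS_bot] at hv
  | succ n ih =>
    intro F hF hd v hv
    obtain ⟨u, hu⟩ := degS_eq_one.1 hv
    have huv : F.Adj v u := (hu u).2 rfl
    have hne : v ≠ u := huv.ne
    have hcard : (F \ SimpleGraph.edge v u).edgeSet.ncard = n := by
      rw [SimpleGraph.edgeSet_sdiff, SimpleGraph.edgeSet_edge_of_ne hne,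
        Set.ncard_sdiff_singleton_of_mem (by simpa using huv), hF]
      rfl
    have hdeg := degS_sdiff_edge huv
    have hsup := sdiff_edge_sup huv
    generalize F \ SimpleGraph.edge v u = F' at *
    have hv0 : degS F' v = 0 := by
      have := hdeg v; rw [degS_edge_left hne] at this; omega
    have hu0 := hdeg u
    rw [degS_edge_right hne] at hu0
    have hiso := degS_eq_zero.1 hv0
    have key : ∀ w', F.Reachable v w' → w' = v ∨ F'.Reachable u w' := by
      intro w' hw'
      rw [← hsup] at hw'
      rcases reachable_sup_edge hw' with h | ⟨-, h⟩ | ⟨h, -⟩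
      · exact Or.inl (h.eq_of_isolated hiso)
      · exact Or.inr h
      · exact absurd (h.eq_of_isolated hiso).symm hne
    have hle : F' ≤ F := hsup ▸ le_sup_left
    rcases (show degS F u = 1 ∨ degS F u = 2 by have := hd u; omega) with h1 | h2
    · refine ⟨u, hne.symm, h1, huv.reachable, fun w' _ hw' => ?_⟩
      rcases key w' hw' with h | h
      · exact Or.inl h
      · exact Or.inr (h.eq_of_isolated (degS_eq_zero.1 (by omega)))
    · obtain ⟨w, hwu, hw1, hrw, huniq⟩ := ih F' hcard
        (fun x => (degS_mono hle x).trans (hd x)) u (by omega)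
      have hwv : w ≠ v := by rintro rfl; omega
      refine ⟨w, hwv, ?_, huv.reachable.trans (hrw.mono hle), fun w' hw'1 hw' => ?_⟩
      · have := hdeg w; rw [degS_edge_of_ne hwv hwu] at this; omega
      · rcases key w' hw' with h | h
        · exact Or.inl h
        · rcases huniq w' ((degS_mono hle w').trans hw'1) h with rfl | rfl
          · omega
          · exact Or.inr rfl

end Degrees

section Linking

variable {α : Type*}

lemma SimpleGraph.symmDiff_adj' {F H : SimpleGraph α} {a b : α} :
    (symmDiff F H).Adj a b ↔ (F.Adj a b ∧ ¬ H.Adj a b) ∨ (H.Adj a b ∧ ¬ F.Adj a b) := by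
  simp [symmDiff]

lemma symmDiff_edge_of_not_adj {F : SimpleGraph α} {s t : α} (h : ¬ F.Adj s t) :
    symmDiff F (SimpleGraph.edge s t) = F ⊔ SimpleGraph.edge s t := by
  ext a b
  rw [SimpleGraph.symmDiff_adj', SimpleGraph.sup_adj, SimpleGraph.edge_adj]
  have := fun h' : F.Adj t s => h h'.symm
  grind

/-- Edges of the graph are pairwise disjoint. -/
def IsMatchingGraph (M : SimpleGraph α) : Prop :=
  ∀ a b c, M.Adj a b → M.Adj a c → b = c

/-- Maximum degree at most two, and every component has a vertex of degree at most one. -/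
def IsPathForest (F : SimpleGraph α) : Prop :=
  (∀ v, degS F v ≤ 2) ∧ ∀ v, ∃ w, F.Reachable v w ∧ degS F w ≤ 1

/-- A path forest whose path ends are partitioned into `S` and `T`, some path joining the two
classes unless one of them is empty. -/
structure IsLinked (F : SimpleGraph α) (S T : Finset α) : Prop where
  forest : IsPathForest F
  degS_one : ∀ v, degS F v = 1 ↔ v ∈ S ∨ v ∈ T
  disj : Disjoint S T
  cross : S.Nonempty → T.Nonempty → ∃ s ∈ S, ∃ t ∈ T, F.Reachable s t

lemma IsLinked.symm {F : SimpleGraph α} {S T : Finset α} (h : IsLinked F S T) :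
    IsLinked F T S where
  forest := h.forest
  degS_one v := by rw [h.degS_one, or_comm]
  disj := h.disj.symm
  cross hT hS := by
    obtain ⟨s, hs, t, ht, hst⟩ := h.cross hS hT
    exact ⟨t, ht, s, hs, hst.symm⟩

lemma exists_closing_graph {S : Finset α} (hS : Even S.card) (h4 : S.card < 4) :
    ∃ P : SimpleGraph α, ((S = ∅ ∧ P = ⊥) ∨
      ∃ s t, s ≠ t ∧ (∀ v, v ∈ S ↔ v = s ∨ v = t) ∧ P = SimpleGraph.edge s t) := by
  rcases (show S.card = 0 ∨ S.card = 2 by obtain ⟨k, hk⟩ := hS; omega) with h | h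
  · exact ⟨_, Or.inl ⟨Finset.card_eq_zero.1 h, rfl⟩⟩
  · classical
    obtain ⟨s, t, hst, rfl⟩ := Finset.card_eq_two.1 h
    exact ⟨_, Or.inr ⟨s, t, hst, by simp, rfl⟩⟩

lemma symmDiff_cancel_pairs (F₁ F₂ F₃ P Q R : SimpleGraph α) :
    symmDiff (symmDiff (symmDiff (symmDiff F₁ P) Q) (symmDiff (symmDiff F₂ P) R))
      (symmDiff (symmDiff F₃ Q) R) = symmDiff (symmDiff F₁ F₂) F₃ := by
  ext a b
  simp only [SimpleGraph.symmDiff_adj']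
  by_cases hp : P.Adj a b <;> by_cases hq : Q.Adj a b <;> by_cases hr : R.Adj a b <;>
    simp only [hp, hq, hr, not_true, not_false_eq_true, and_true, and_false, true_and, false_and,
      or_false, false_or, not_not] <;> tauto

variable [Finite α]

lemma IsMatchingGraph.even_card_support {M : SimpleGraph α} (hM : IsMatchingGraph M)
    {S : Finset α} (hS : ∀ v, v ∈ S ↔ ∃ w, M.Adj v w) : Even S.card := by
  classical
  have := Fintype.ofFinite α
  have h := M.even_card_odd_degree_vertices
  convert h using 2
  ext v
  rw [hS, Finset.mem_filter]
  constructor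
  · rintro ⟨w, hw⟩
    refine ⟨Finset.mem_univ _, ?_⟩
    have : M.degree v = 1 := by
      rw [SimpleGraph.degree_eq_one_iff_existsUnique_adj]
      exact ⟨w, hw, fun y hy => hM _ _ _ hy hw⟩
    rw [this]; exact odd_one
  · rintro ⟨-, h⟩
    have : 0 < M.degree v := h.pos
    rwa [SimpleGraph.degree_pos_iff_exists_adj] at this

lemma eq_of_reachable_ends {F : SimpleGraph α} (hF : ∀ v, degS F v ≤ 2) {v a b : α}
    (hv : degS F v = 1) (ha : degS F a ≤ 1) (hb : degS F b ≤ 1) (hav : a ≠ v) (hbv : b ≠ v)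
    (hra : F.Reachable v a) (hrb : F.Reachable v b) : a = b := by
  obtain ⟨w, -, -, -, hu⟩ := exists_partner _ F rfl hF v hv
  have h1 := hu a ha hra
  have h2 := hu b hb hrb
  grind

lemma exists_end {F : SimpleGraph α} (hF : ∀ v, degS F v ≤ 2) {s : α} (hs : degS F s ≤ 1) :
    ∃ s', F.Reachable s s' ∧ ((s' = s ∧ degS F s = 0) ∨ (s' ≠ s ∧ degS F s' = 1)) := by
  rcases Nat.le_one_iff_eq_zero_or_eq_one.1 hs with h | h
  · exact ⟨s, SimpleGraph.Reachable.refl _, Or.inl ⟨rfl, h⟩⟩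
  · obtain ⟨w, hw, hw1, hr, -⟩ := exists_partner _ F rfl hF s h
    exact ⟨w, hr, Or.inr ⟨hw, hw1⟩⟩

lemma IsPathForest.sup_edge {F : SimpleGraph α} (hF : IsPathForest F) {s t : α}
    (hs : degS F s ≤ 1) (ht : degS F t ≤ 1) (hst : ¬ F.Reachable s t) :
    IsPathForest (F ⊔ SimpleGraph.edge s t) := by
  have hne : s ≠ t := by rintro rfl; exact hst (SimpleGraph.Reachable.refl _)
  have hdeg := degS_sup_edge (fun h : F.Adj s t => hst h.reachable)
  have hds := degS_edge_left hne
  have hdt := degS_edge_right hne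
  refine ⟨fun v => ?_, fun v => ?_⟩
  · rw [hdeg]
    by_cases h1 : v = s
    · subst h1; omega
    by_cases h2 : v = t
    · subst h2; omega
    have := hF.1 v
    rw [degS_edge_of_ne h1 h2]; omega
  · obtain ⟨w, hvw, hw⟩ := hF.2 v
    have hle : F ≤ F ⊔ SimpleGraph.edge s t := le_sup_left
    by_cases h1 : w = s
    · subst h1
      obtain ⟨s', hr, h⟩ := exists_end hF.1 hs
      refine ⟨s', (hvw.trans hr).mono hle, ?_⟩
      rw [hdeg]
      rcases h with ⟨rfl, h⟩ | ⟨h, h'⟩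
      · omega
      · rw [degS_edge_of_ne h (by rintro rfl; exact hst hr)]; omega
    by_cases h2 : w = t
    · subst h2
      obtain ⟨s', hr, h⟩ := exists_end hF.1 ht
      refine ⟨s', (hvw.trans hr).mono hle, ?_⟩
      rw [hdeg]
      rcases h with ⟨rfl, h⟩ | ⟨h, h'⟩
      · omega
      · rw [degS_edge_of_ne (by rintro rfl; exact hst hr.symm) h]; omega
    refine ⟨w, hvw.mono hle, ?_⟩
    rw [hdeg, degS_edge_of_ne h1 h2]; omega

lemma IsPathForest.eq_bot {F : SimpleGraph α} (hF : IsPathForest F)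
    (h : ∀ v, degS F v ≠ 1) : F = ⊥ := by
  ext a b
  simp only [SimpleGraph.bot_adj, iff_false]
  intro hab
  obtain ⟨w, hw, hw1⟩ := hF.2 a
  have hw0 := h w
  have := hw.symm.eq_of_isolated (degS_eq_zero.1 (by omega))
  subst this
  exact degS_eq_zero.1 (by omega) _ hab

lemma IsPathForest.close_one {F : SimpleGraph α} (hF : IsPathForest F) {s t : α}
    (hst : s ≠ t) (h : ∀ v, degS F v = 1 ↔ v = s ∨ v = t) :
    symmDiff F (SimpleGraph.edge s t) = ⊥ ∨ IsCycleGraph (symmDiff F (SimpleGraph.edge s t)) := by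
  have hreach : ∀ v, 0 < degS F v → F.Reachable v s ∨ F.Reachable v t := by
    intro v hv
    obtain ⟨w, hw, hw1⟩ := hF.2 v
    rcases Nat.le_one_iff_eq_zero_or_eq_one.1 hw1 with h0 | h0
    · have := hw.symm.eq_of_isolated (degS_eq_zero.1 h0)
      subst this; omega
    · rcases (h w).1 h0 with rfl | rfl
      · exact Or.inl hw
      · exact Or.inr hw
  by_cases hadj : F.Adj s t
  · left
    have hs := degS_le_one.1 ((h s).2 (Or.inl rfl)).le
    have ht := degS_le_one.1 ((h t).2 (Or.inr rfl)).le
    have hcl : ∀ a b, (a = s ∨ a = t) → F.Adj a b → (b = s ∨ b = t) := by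
      rintro a b (rfl | rfl) hab
      · exact Or.inr (hs _ _ hab hadj)
      · exact Or.inl (ht _ _ hab hadj.symm)
    have hall : ∀ v, 0 < degS F v → v = s ∨ v = t := by
      intro v hv
      rcases hreach v hv with hr | hr
      · exact hr.symm.mem_of_closed hcl (Or.inl rfl)
      · exact hr.symm.mem_of_closed hcl (Or.inr rfl)
    rw [symmDiff_eq_bot]
    ext a b
    rw [SimpleGraph.edge_adj]
    constructor
    · intro hab
      have h1 := hall a (degS_pos.2 ⟨_, hab⟩)
      have h2 := hall b (degS_pos.2 ⟨_, hab.symm⟩)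
      have := hab.ne
      grind
    · rintro ⟨⟨rfl, rfl⟩ | ⟨rfl, rfl⟩, -⟩
      · exact hadj
      · exact hadj.symm
  · right
    rw [symmDiff_edge_of_not_adj hadj]
    have hdeg := degS_sup_edge hadj
    have hds := degS_edge_left hst
    have hdt := degS_edge_right hst
    have hedge : (F ⊔ SimpleGraph.edge s t).Adj s t := Or.inr hst.edge_adj'
    have hle : F ≤ F ⊔ SimpleGraph.edge s t := le_sup_left
    refine ⟨?_, fun v => ?_, ?_⟩
    · intro h0
      rw [h0] at hedge
      exact hedge
    · have hv := h v
      have hv2 := hF.1 v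
      rw [hdeg]
      by_cases h1 : v = s
      · have := hv.2 (Or.inl h1)
        subst h1; omega
      by_cases h2 : v = t
      · have := hv.2 (Or.inr h2)
        subst h2; omega
      have : degS F v ≠ 1 := fun h' => (hv.1 h').elim h1 h2
      rw [degS_edge_of_ne h1 h2]; omega
    · have key : ∀ v, 0 < degS (F ⊔ SimpleGraph.edge s t) v →
          (F ⊔ SimpleGraph.edge s t).Reachable v s := by
        intro v hv
        by_cases h1 : v = s
        · subst h1; exact SimpleGraph.Reachable.refl _
        by_cases h2 : v = t
        · subst h2; exact hedge.reachable.symm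
        rw [hdeg, degS_edge_of_ne h1 h2] at hv
        rcases hreach v hv with hr | hr
        · exact hr.mono hle
        · exact (hr.mono hle).trans hedge.reachable.symm
      exact fun u v hu hv => (key u hu).trans (key v hv).symm

lemma IsLinked.close {F : SimpleGraph α} {S T : Finset α} (h : IsLinked F S T)
    {P Q : SimpleGraph α}
    (hP : (S = ∅ ∧ P = ⊥) ∨
      ∃ s t, s ≠ t ∧ (∀ v, v ∈ S ↔ v = s ∨ v = t) ∧ P = SimpleGraph.edge s t)
    (hQ : (T = ∅ ∧ Q = ⊥) ∨
      ∃ s t, s ≠ t ∧ (∀ v, v ∈ T ↔ v = s ∨ v = t) ∧ Q = SimpleGraph.edge s t) :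
    symmDiff (symmDiff F P) Q = ⊥ ∨ IsCycleGraph (symmDiff (symmDiff F P) Q) := by
  have hd1 := h.degS_one
  rcases hP with ⟨rfl, rfl⟩ | ⟨s, t, hst, hS, rfl⟩ <;>
    rcases hQ with ⟨rfl, rfl⟩ | ⟨q, r, hqr, hT, rfl⟩
  · left
    simpa using h.forest.eq_bot (by simpa using hd1)
  · rw [symmDiff_bot]
    exact h.forest.close_one hqr (by simpa [hT] using hd1)
  · rw [symmDiff_bot]
    exact h.forest.close_one hst (by simpa [hS] using hd1)
  · have hdis := Finset.disjoint_left.1 h.disj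
    have hle1 : ∀ v, v ∈ S ∨ v ∈ T → degS F v ≤ 1 := fun v hv => ((hd1 v).2 hv).le
    have hnr : ¬ F.Reachable s t := by
      intro hr
      obtain ⟨a, ha, b, hb, hab⟩ := h.cross ⟨s, (hS s).2 (Or.inl rfl)⟩ ⟨q, (hT q).2 (Or.inl rfl)⟩
      have hs : s ∈ S := (hS s).2 (Or.inl rfl)
      have ht : t ∈ S := (hS t).2 (Or.inr rfl)
      rcases (hS a).1 ha with rfl | rfl
      · have := eq_of_reachable_ends h.forest.1 ((hd1 a).2 (Or.inl ha)) (hle1 t (Or.inl ht))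
          (hle1 b (Or.inr hb)) hst.symm (by rintro rfl; exact hdis ha hb) hr hab
        subst this; exact hdis ht hb
      · have := eq_of_reachable_ends h.forest.1 ((hd1 a).2 (Or.inl ha)) (hle1 s (Or.inl hs))
          (hle1 b (Or.inr hb)) hst (by rintro rfl; exact hdis ha hb) hr.symm hab
        subst this; exact hdis hs hb
    have hnadj : ¬ F.Adj s t := fun h' => hnr h'.reachable
    rw [symmDiff_edge_of_not_adj hnadj]
    have hsS : s ∈ S := (hS s).2 (Or.inl rfl)
    have htS : t ∈ S := (hS t).2 (Or.inr rfl)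
    refine (h.forest.sup_edge (hle1 s (Or.inl hsS)) (hle1 t (Or.inl htS)) hnr).close_one hqr
      fun v => ?_
    have hds := degS_edge_left hst
    have hdt := degS_edge_right hst
    rw [degS_sup_edge hnadj, ← hT]
    by_cases h1 : v = s
    · subst h1; have := (hd1 v).2 (Or.inl hsS)
      exact ⟨fun h' => by omega, fun h' => absurd h' (hdis hsS)⟩
    by_cases h2 : v = t
    · subst h2; have := (hd1 v).2 (Or.inl htS)
      exact ⟨fun h' => by omega, fun h' => absurd h' (hdis htS)⟩
    rw [degS_edge_of_ne h1 h2, add_zero, hd1, hS]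
    tauto

lemma IsLinked.sup_edge [DecidableEq α] {F : SimpleGraph α} {S T : Finset α}
    (h : IsLinked F S T) {s t : α} (hs : s ∈ S) (ht : t ∈ S) (hr : ¬ F.Reachable s t)
    (hc : ((S.erase s).erase t).Nonempty → T.Nonempty →
      ∃ a ∈ (S.erase s).erase t, ∃ b ∈ T, (F ⊔ SimpleGraph.edge s t).Reachable a b) :
    IsLinked (F ⊔ SimpleGraph.edge s t) ((S.erase s).erase t) T where
  forest := h.forest.sup_edge ((h.degS_one s).2 (Or.inl hs)).le
    ((h.degS_one t).2 (Or.inl ht)).le hr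
  degS_one v := by
    have hst : s ≠ t := by rintro rfl; exact hr (SimpleGraph.Reachable.refl _)
    have hdis := Finset.disjoint_left.1 h.disj
    have hds := degS_edge_left hst
    have hdt := degS_edge_right hst
    rw [degS_sup_edge (fun h' => hr h'.reachable)]
    by_cases h1 : v = s
    · subst h1; have := (h.degS_one v).2 (Or.inl hs); have := hdis hs; simp [*]
    by_cases h2 : v = t
    · subst h2; have := (h.degS_one v).2 (Or.inl ht); have := hdis ht; simp [*]
    rw [degS_edge_of_ne h1 h2, add_zero, h.degS_one]
    simp [h1, h2]
  disj := h.disj.mono_left ((Finset.erase_subset _ _).trans (Finset.erase_subset _ _))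
  cross := hc

lemma IsLinked.exists_link [DecidableEq α] {F : SimpleGraph α} {S T : Finset α}
    (h : IsLinked F S T) (hS : Even S.card) {s : α} (hs : s ∈ S) :
    ∃ t₀, ∀ t ∈ S, t ≠ s → t ≠ t₀ → ¬ F.Reachable s t ∧
      IsLinked (F ⊔ SimpleGraph.edge s t) ((S.erase s).erase t) T := by
  have hd1 := h.degS_one
  have hle1 : ∀ v, v ∈ S ∨ v ∈ T → degS F v ≤ 1 := fun v hv => ((hd1 v).2 hv).le
  have hdis := Finset.disjoint_left.1 h.disj
  obtain ⟨r, hrs, hr1, hsr, hu⟩ := exists_partner _ F rfl h.forest.1 s ((hd1 s).2 (Or.inl hs))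
  have hle : ∀ t, F ≤ F ⊔ SimpleGraph.edge s t := fun t => le_sup_left
  rcases (hd1 r).1 hr1 with hrS | hrT
  · refine ⟨r, fun t ht hts htr => ?_⟩
    have hnr : ¬ F.Reachable s t := fun h' => by
      rcases hu t (hle1 t (Or.inl ht)) h' with h | h
      · exact hts h
      · exact htr h
    refine ⟨hnr, h.sup_edge hs ht hnr fun _ hT => ?_⟩
    obtain ⟨a, ha, b, hb, hab⟩ := h.cross ⟨s, hs⟩ hT
    have has : a ≠ s := by
      rintro rfl
      rcases hu b (hle1 b (Or.inr hb)) hab with rfl | rfl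
      · exact hdis ha hb
      · exact hdis hrS hb
    by_cases hat : a = t
    · subst hat
      refine ⟨r, by simp [hrS, hrs, Ne.symm htr], b, hb, ?_⟩
      have : (F ⊔ SimpleGraph.edge s a).Adj s a := Or.inr hts.symm.edge_adj'
      exact ((hsr.symm.mono (hle a)).trans this.reachable).trans (hab.mono (hle a))
    · exact ⟨a, by simp [ha, has, hat], b, hb, hab.mono (hle t)⟩
  · obtain ⟨s₂, hs₂, hs₂s, hcr⟩ : ∃ s₂ ∈ S, s₂ ≠ s ∧ ∃ b ∈ T, F.Reachable s₂ b := by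
      by_contra! hcon
      let M : SimpleGraph α :=
        { Adj := fun a b => a ≠ b ∧ a ∈ S ∧ b ∈ S ∧ F.Reachable a b
          symm := ⟨fun a b hab => ⟨hab.1.symm, hab.2.2.1, hab.2.1, hab.2.2.2.symm⟩⟩
          loopless := ⟨fun a ha => ha.1 rfl⟩ }
      have hM : IsMatchingGraph M := by
        rintro a b c ⟨hab, ha, hb, hrab⟩ ⟨hac, -, hc, hrac⟩
        exact eq_of_reachable_ends h.forest.1 ((hd1 a).2 (Or.inl ha)) (hle1 b (Or.inl hb))
          (hle1 c (Or.inl hc)) hab.symm hac.symm hrab hrac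
      have := hM.even_card_support (S := S.erase s) (by
        intro v
        rw [Finset.mem_erase]
        constructor
        · rintro ⟨hvs, hv⟩
          obtain ⟨w, hwv, hw1, hvw, -⟩ :=
            exists_partner _ F rfl h.forest.1 v ((hd1 v).2 (Or.inl hv))
          rcases (hd1 w).1 hw1 with hw | hw
          · exact ⟨w, hwv.symm, hv, hw, hvw⟩
          · exact (hcon v hv hvs w hw hvw).elim
        · rintro ⟨w, hvw, hv, hw, hr⟩
          refine ⟨?_, hv⟩
          rintro rfl
          rcases hu w (hle1 w (Or.inl hw)) hr with h | rfl
          · exact hvw h.symm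
          · exact hdis hw hrT)
      rw [Finset.card_erase_of_mem hs] at this
      have hpos := Finset.card_pos.2 ⟨s, hs⟩
      obtain ⟨k, hk⟩ := hS
      obtain ⟨l, hl⟩ := this
      omega
    refine ⟨s₂, fun t ht hts htr => ?_⟩
    have hnr : ¬ F.Reachable s t := fun h' => by
      rcases hu t (hle1 t (Or.inl ht)) h' with h | h
      · exact hts h
      · exact hdis ht (h ▸ hrT)
    refine ⟨hnr, h.sup_edge hs ht hnr fun _ hT => ?_⟩
    obtain ⟨b, hb, hab⟩ := hcr
    exact ⟨s₂, by simp [hs₂, hs₂s, Ne.symm htr], b, hb, hab.mono (hle t)⟩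

/-- Three pairwise linked path forests with matching sets of path ends have the same symmetric
difference as three graphs each of which is empty or a cycle. -/
theorem exists_cycles_of_isLinked : ∀ (n : ℕ) (F₁ F₂ F₃ : SimpleGraph α) (A B C : Finset α),
    A.card + B.card + C.card = n → Even A.card → Even B.card → Even C.card →
    IsLinked F₁ A B → IsLinked F₂ A C → IsLinked F₃ B C →
    ∃ C₁ C₂ C₃ : SimpleGraph α, (C₁ = ⊥ ∨ IsCycleGraph C₁) ∧ (C₂ = ⊥ ∨ IsCycleGraph C₂) ∧
      (C₃ = ⊥ ∨ IsCycleGraph C₃) ∧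
      symmDiff (symmDiff C₁ C₂) C₃ = symmDiff (symmDiff F₁ F₂) F₃ := by
  classical
  intro n
  induction n using Nat.strong_induction_on with
  | _ n ih =>
  have key : ∀ (F₁ F₂ F₃ : SimpleGraph α) (A B C : Finset α),
      A.card + B.card + C.card = n → Even A.card → Even B.card → Even C.card →
      IsLinked F₁ A B → IsLinked F₂ A C → IsLinked F₃ B C → 4 ≤ A.card →
      ∃ C₁ C₂ C₃ : SimpleGraph α, (C₁ = ⊥ ∨ IsCycleGraph C₁) ∧ (C₂ = ⊥ ∨ IsCycleGraph C₂) ∧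
        (C₃ = ⊥ ∨ IsCycleGraph C₃) ∧
        symmDiff (symmDiff C₁ C₂) C₃ = symmDiff (symmDiff F₁ F₂) F₃ := by
    intro F₁ F₂ F₃ A B C hn hA hB hC h₁ h₂ h₃ h4
    obtain ⟨s, hs⟩ := Finset.card_pos.1 (show 0 < A.card by omega)
    obtain ⟨t₁, ht₁⟩ := h₁.exists_link hA hs
    obtain ⟨t₂, ht₂⟩ := h₂.exists_link hA hs
    obtain ⟨t, ht, htn⟩ := Finset.exists_mem_notMem_of_card_lt_card
      (s := {s, t₁, t₂}) (t := A) (lt_of_le_of_lt Finset.card_le_three (by omega))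
    simp only [Finset.mem_insert, Finset.mem_singleton, not_or] at htn
    obtain ⟨hn₁, hl₁⟩ := ht₁ t ht htn.1 htn.2.1
    obtain ⟨hn₂, hl₂⟩ := ht₂ t ht htn.1 htn.2.2
    have hcard : ((A.erase s).erase t).card = A.card - 2 := by
      rw [Finset.card_erase_of_mem (by simp [ht, htn.1]), Finset.card_erase_of_mem hs]; omega
    obtain ⟨C₁, C₂, C₃, h1, h2, h3, h4⟩ := ih (n - 2) (by omega) _ _ F₃ _ B C
      (by rw [hcard]; omega) (by rw [hcard]; obtain ⟨k, hk⟩ := hA; exact ⟨k - 1, by omega⟩)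
      hB hC hl₁ hl₂ h₃
    refine ⟨C₁, C₂, C₃, h1, h2, h3, ?_⟩
    rw [h4, ← symmDiff_edge_of_not_adj fun h => hn₁ h.reachable,
      ← symmDiff_edge_of_not_adj fun h => hn₂ h.reachable, symmDiff_symmDiff_symmDiff_comm,
      symmDiff_self, symmDiff_bot]
  intro F₁ F₂ F₃ A B C hn hA hB hC h₁ h₂ h₃
  by_cases hA4 : 4 ≤ A.card
  · exact key F₁ F₂ F₃ A B C hn hA hB hC h₁ h₂ h₃ hA4
  by_cases hB4 : 4 ≤ B.card
  · obtain ⟨C₁, C₂, C₃, h1, h2, h3, h4⟩ :=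
      key F₁ F₃ F₂ B A C (by omega) hB hA hC h₁.symm h₃ h₂ hB4
    refine ⟨C₁, C₃, C₂, h1, h3, h2, ?_⟩
    rw [symmDiff_right_comm, h4, symmDiff_right_comm]
  by_cases hC4 : 4 ≤ C.card
  · obtain ⟨C₁, C₂, C₃, h1, h2, h3, h4⟩ :=
      key F₂ F₃ F₁ C A B (by omega) hC hA hB h₂.symm h₃.symm h₁ hC4
    refine ⟨C₃, C₁, C₂, h3, h1, h2, ?_⟩
    rw [symmDiff_assoc, symmDiff_comm, h4, symmDiff_comm, symmDiff_assoc]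
  obtain ⟨P, hP⟩ := exists_closing_graph hA (by omega)
  obtain ⟨Q, hQ⟩ := exists_closing_graph hB (by omega)
  obtain ⟨R, hR⟩ := exists_closing_graph hC (by omega)
  refine ⟨_, _, _, h₁.close hP hQ, h₂.close hP hR, h₃.close hQ hR, ?_⟩
  exact symmDiff_cancel_pairs _ _ _ _ _ _

end Linking

section Transversals

variable {α : Type*}

lemma exists_list_of_cycles {G C₁ C₂ C₃ : SimpleGraph α} (h₁ : C₁ = ⊥ ∨ IsCycleGraph C₁)
    (h₂ : C₂ = ⊥ ∨ IsCycleGraph C₂) (h₃ : C₃ = ⊥ ∨ IsCycleGraph C₃)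
    (h : symmDiff (symmDiff C₁ C₂) C₃ = G) :
    ∃ L : List (SimpleGraph α), L.length ≤ 3 ∧ (∀ C ∈ L, IsCycleGraph C) ∧
      listSymmDiff L = G := by
  have step : ∀ (C : SimpleGraph α) (L : List (SimpleGraph α)), (C = ⊥ ∨ IsCycleGraph C) →
      (∀ C ∈ L, IsCycleGraph C) → ∃ L' : List (SimpleGraph α), L'.length ≤ L.length + 1 ∧
        (∀ C ∈ L', IsCycleGraph C) ∧ listSymmDiff L' = symmDiff C (listSymmDiff L) := by
    rintro C L (rfl | hC) hL
    · exact ⟨L, by omega, hL, by simp⟩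
    · exact ⟨C :: L, by simp, by simpa using ⟨hC, hL⟩, rfl⟩
  obtain ⟨L₃, hl₃, hc₃, he₃⟩ := step C₃ [] h₃ (by simp)
  obtain ⟨L₂, hl₂, hc₂, he₂⟩ := step C₂ L₃ h₂ hc₃
  obtain ⟨L₁, hl₁, hc₁, he₁⟩ := step C₁ L₂ h₁ hc₂
  refine ⟨L₁, by simp at hl₃; omega, hc₁, ?_⟩
  rw [he₁, he₂, he₃, ← h, symmDiff_assoc]
  simp [listSymmDiff]

/-- A set of edges of `A` with exactly one edge in every nontrivial component. -/
structure IsTransversal (A M : SimpleGraph α) : Prop where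
  le : M ≤ A
  unique : ∀ a b c d, M.Adj a b → M.Adj c d → A.Reachable a c → s(a, b) = s(c, d)
  hits : ∀ v w, A.Adj v w → ∃ a b, M.Adj a b ∧ A.Reachable v a

lemma IsTransversal.isMatchingGraph {A M : SimpleGraph α} (h : IsTransversal A M) :
    IsMatchingGraph M := by
  intro a b c hab hac
  have := h.unique a b a c hab hac (SimpleGraph.Reachable.refl _)
  simp only [Sym2.eq_iff, true_and] at this
  grind

lemma exists_isTransversal (A : SimpleGraph α) (ok : α → α → Prop)
    (h : ∀ v w, A.Adj v w → ∃ a b, A.Adj a b ∧ A.Reachable v a ∧ ok a b) :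
    ∃ M, IsTransversal A M ∧ ∀ a b, M.Adj a b → ok a b ∨ ok b a := by
  have hex : ∀ c : A.ConnectedComponent, ∃ p : α × α, (∃ v w, A.connectedComponentMk v = c ∧
      A.Adj v w) → A.Adj p.1 p.2 ∧ A.connectedComponentMk p.1 = c ∧ ok p.1 p.2 := by
    intro c
    by_cases hc : ∃ v w, A.connectedComponentMk v = c ∧ A.Adj v w
    · obtain ⟨v, w, rfl, hvw⟩ := hc
      obtain ⟨a, b, hab, hr, hok⟩ := h v w hvw
      exact ⟨(a, b), fun _ => ⟨hab, SimpleGraph.ConnectedComponent.sound hr.symm, hok⟩⟩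
    · obtain ⟨v, -⟩ := c.exists_rep
      exact ⟨(v, v), fun h' => (hc h').elim⟩
  choose f hf using hex
  let M : SimpleGraph α :=
    { Adj := fun a b => A.Adj a b ∧
        (f (A.connectedComponentMk a) = (a, b) ∨ f (A.connectedComponentMk a) = (b, a))
      symm := ⟨fun a b ⟨hab, h⟩ => by
        have : A.connectedComponentMk a = A.connectedComponentMk b :=
          SimpleGraph.ConnectedComponent.sound hab.reachable
        rw [this] at h
        exact ⟨hab.symm, h.symm⟩⟩
      loopless := ⟨fun a h => h.1.ne rfl⟩ }
  refine ⟨M, ⟨fun a b hab => hab.1, ?_, ?_⟩, ?_⟩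
  · rintro a b c d ⟨-, hab⟩ ⟨-, hcd⟩ hr
    rw [← SimpleGraph.ConnectedComponent.sound hr] at hcd
    rw [Sym2.eq_iff]
    generalize f (A.connectedComponentMk a) = p at *
    obtain ⟨p, q⟩ := p
    simp only [Prod.mk.injEq] at hab hcd
    grind
  · intro v w hvw
    obtain ⟨hadj, hc, -⟩ := hf (A.connectedComponentMk v) ⟨v, w, rfl, hvw⟩
    refine ⟨_, _, ⟨hadj, ?_⟩, (SimpleGraph.ConnectedComponent.exact hc).symm⟩
    rw [hc]; exact Or.inl rfl
  · rintro a b ⟨hab, h⟩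
    obtain ⟨-, -, hok⟩ := hf (A.connectedComponentMk a) ⟨a, b, rfl, hab⟩
    rcases h with h | h <;> rw [h] at hok
    · exact Or.inl hok
    · exact Or.inr hok

lemma IsPolycycle.degS_le {A : SimpleGraph α} (hA : IsPolycycle A) (v : α) : degS A v ≤ 2 := by
  have := hA v; omega

lemma IsPathForest.isLinked_empty {F : SimpleGraph α} (hF : IsPathForest F) {S : Finset α}
    (hS : ∀ v, degS F v = 1 ↔ v ∈ S) : IsLinked F S ∅ where
  forest := hF
  degS_one := by simpa using hS
  disj := by simp
  cross := by simp

variable [Finite α]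

/-- The non-isolated vertices of a graph. -/
noncomputable def verts (M : SimpleGraph α) : Finset α := M.support.toFinite.toFinset

lemma mem_verts {M : SimpleGraph α} {v : α} : v ∈ verts M ↔ ∃ w, M.Adj v w := by
  simp [verts, SimpleGraph.mem_support]

lemma IsMatchingGraph.even_card_verts {M : SimpleGraph α} (hM : IsMatchingGraph M) :
    Even (verts M).card := hM.even_card_support fun _ => mem_verts

lemma IsMatchingGraph.degS_of_mem {M : SimpleGraph α} (hM : IsMatchingGraph M) {v : α}
    (hv : v ∈ verts M) : degS M v = 1 := by
  have h1 := degS_le_one.2 (hM v)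
  have := degS_pos.2 (mem_verts.1 hv)
  omega

lemma degS_of_notMem_verts {M : SimpleGraph α} {v : α} (hv : v ∉ verts M) : degS M v = 0 := by
  rw [mem_verts] at hv
  rw [degS_eq_zero]; push Not at hv; exact hv

lemma IsPolycycle.degS_eq_two {A : SimpleGraph α} (hA : IsPolycycle A) {v w : α}
    (h : A.Adj v w) : degS A v = 2 := by
  have := hA v
  have := degS_pos.2 ⟨w, h⟩
  omega

lemma degS_sdiff_eq_one {A M : SimpleGraph α} (hA : IsPolycycle A) (hM : IsMatchingGraph M)
    (hle : M ≤ A) (v : α) : degS (A \ M) v = 1 ↔ v ∈ verts M := by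
  have h := degS_sdiff hle v
  constructor
  · intro h1
    by_contra hv
    have := degS_of_notMem_verts hv
    have := hA v
    omega
  · intro hv
    obtain ⟨w, hw⟩ := mem_verts.1 hv
    have := hA.degS_eq_two (hle hw)
    have := hM.degS_of_mem hv
    omega

/-- Removing a matching that meets every component of a polycycle leaves a path forest. -/
lemma IsPolycycle.isPathForest_sdiff {A M : SimpleGraph α} (hA : IsPolycycle A)
    (hM : IsMatchingGraph M) (hle : M ≤ A)
    (hits : ∀ v w, A.Adj v w → ∃ a b, M.Adj a b ∧ A.Reachable v a) : IsPathForest (A \ M) := by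
  refine ⟨fun v => ?_, fun v => ?_⟩
  · exact (degS_mono sdiff_le v).trans (hA.degS_le v)
  · by_cases hv : ∃ w, A.Adj v w
    · obtain ⟨w, hw⟩ := hv
      obtain ⟨a, b, hab, hr⟩ := hits v w hw
      have ha : a ∈ verts M := mem_verts.2 ⟨b, hab⟩
      have : ∃ w ∈ verts M, (A \ M).Reachable v w := by
        clear hw
        rw [SimpleGraph.reachable_iff_reflTransGen] at hr
        induction hr using Relation.ReflTransGen.head_induction_on with
        | refl => exact ⟨a, ha, SimpleGraph.Reachable.refl _⟩
        | @head c d hcd _ ih =>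
          by_cases hc : c ∈ verts M
          · exact ⟨c, hc, SimpleGraph.Reachable.refl _⟩
          · obtain ⟨w, hw, hdw⟩ := ih
            refine ⟨w, hw, SimpleGraph.Reachable.trans ?_ hdw⟩
            apply SimpleGraph.Adj.reachable
            rw [SimpleGraph.sdiff_adj]
            exact ⟨hcd, fun h => hc (mem_verts.2 ⟨d, h⟩)⟩
      obtain ⟨w, hw, hvw⟩ := this
      exact ⟨w, hvw, ((degS_sdiff_eq_one hA hM hle w).2 hw).le⟩
    · push Not at hv
      refine ⟨v, SimpleGraph.Reachable.refl _, ?_⟩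
      have := degS_eq_zero.2 hv
      have := degS_mono (sdiff_le : A \ M ≤ A) v
      omega

lemma IsMatchingGraph.isPathForest {M : SimpleGraph α} (hM : IsMatchingGraph M) :
    IsPathForest M := by
  have : ∀ v, degS M v ≤ 1 := fun v => degS_le_one.2 (hM v)
  exact ⟨fun v => (this v).trans (by norm_num),
    fun v => ⟨v, SimpleGraph.Reachable.refl _, this v⟩⟩

theorem exists_two_cycles_of_isLinked : ∀ (n : ℕ) (F₁ F₂ : SimpleGraph α) (S : Finset α),
    S.card = n → Even S.card → IsLinked F₁ S ∅ → IsLinked F₂ S ∅ →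
    ∃ C₁ C₂ : SimpleGraph α, (C₁ = ⊥ ∨ IsCycleGraph C₁) ∧ (C₂ = ⊥ ∨ IsCycleGraph C₂) ∧
      symmDiff C₁ C₂ = symmDiff F₁ F₂ := by
  classical
  intro n
  induction n using Nat.strong_induction_on with
  | _ n ih =>
  intro F₁ F₂ S hn hS h₁ h₂
  by_cases h4 : 4 ≤ S.card
  · obtain ⟨s, hs⟩ := Finset.card_pos.1 (show 0 < S.card by omega)
    obtain ⟨t₁, ht₁⟩ := h₁.exists_link hS hs
    obtain ⟨t₂, ht₂⟩ := h₂.exists_link hS hs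
    obtain ⟨t, ht, htn⟩ := Finset.exists_mem_notMem_of_card_lt_card
      (s := {s, t₁, t₂}) (t := S) (lt_of_le_of_lt Finset.card_le_three (by omega))
    simp only [Finset.mem_insert, Finset.mem_singleton, not_or] at htn
    obtain ⟨hn₁, hl₁⟩ := ht₁ t ht htn.1 htn.2.1
    obtain ⟨hn₂, hl₂⟩ := ht₂ t ht htn.1 htn.2.2
    have hcard : ((S.erase s).erase t).card = S.card - 2 := by
      rw [Finset.card_erase_of_mem (by simp [ht, htn.1]), Finset.card_erase_of_mem hs]; omega
    obtain ⟨C₁, C₂, h1, h2, h4⟩ := ih (n - 2) (by omega) _ _ _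
      (by rw [hcard]; omega) (by rw [hcard]; obtain ⟨k, hk⟩ := hS; exact ⟨k - 1, by omega⟩)
      hl₁ hl₂
    refine ⟨C₁, C₂, h1, h2, ?_⟩
    rw [h4, ← symmDiff_edge_of_not_adj fun h => hn₁ h.reachable,
      ← symmDiff_edge_of_not_adj fun h => hn₂ h.reachable, symmDiff_symmDiff_symmDiff_comm,
      symmDiff_self, symmDiff_bot]
  · obtain ⟨P, hP⟩ := exists_closing_graph hS (by omega)
    refine ⟨_, _, h₁.close hP (Or.inl ⟨rfl, rfl⟩), h₂.close hP (Or.inl ⟨rfl, rfl⟩), ?_⟩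
    rw [symmDiff_bot, symmDiff_bot, symmDiff_symmDiff_symmDiff_comm, symmDiff_self, symmDiff_bot]

/-- A polycycle is the symmetric difference of at most two cycles. -/
theorem IsPolycycle.exists_two_cycles {P : SimpleGraph α} (hP : IsPolycycle P) :
    ∃ C₁ C₂ : SimpleGraph α, (C₁ = ⊥ ∨ IsCycleGraph C₁) ∧ (C₂ = ⊥ ∨ IsCycleGraph C₂) ∧
      symmDiff C₁ C₂ = P := by
  obtain ⟨M, hM, -⟩ := exists_isTransversal P (fun _ _ => True)
    (fun v w h => ⟨v, w, h, SimpleGraph.Reachable.refl _, trivial⟩)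
  have hm := hM.isMatchingGraph
  obtain ⟨C₁, C₂, h₁, h₂, h⟩ := exists_two_cycles_of_isLinked _ (P \ M) M (verts M) rfl
    hm.even_card_verts
    ((hP.isPathForest_sdiff hm hM.le hM.hits).isLinked_empty (degS_sdiff_eq_one hP hm hM.le))
    (hm.isPathForest.isLinked_empty fun v => ⟨fun h => by
      by_contra hv
      have := degS_of_notMem_verts hv
      omega, hm.degS_of_mem⟩)
  refine ⟨C₁, C₂, h₁, h₂, h.trans ?_⟩
  rw [sdiff_symmDiff_eq_sup, sup_eq_left.2 hM.le]

end Transversals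

section Decomposition

variable {α : Type*}

lemma degS_eq_card [Fintype α] (G : SimpleGraph α) [DecidableRel G.Adj] (v : α) :
    degS G v = (Finset.univ.filter fun w => G.Adj v w).card := by
  unfold degS
  rw [← Set.ncard_coe_finset]
  congr 1
  ext w; simp

lemma two_mul_card_filter_fin_two {d : ℕ} (hd : Even d) (h : d ≤ 4) :
    2 * ((Finset.univ : Finset (Fin 2)).filter fun i : Fin 2 => 2 * (i : ℕ) < d).card = d := by
  interval_cases d
  · rfl
  · exact absurd hd (by decide)
  · rfl
  · exact absurd hd (by decide)
  · rfl

/-- An Eulerian graph of maximum degree at most four has a balanced orientation. -/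
lemma exists_balanced_orientation [Fintype α] (G : SimpleGraph α)
    (hEuler : ∀ v, Even (degS G v)) (hle : ∀ v, degS G v ≤ 4) :
    ∃ D : α → α → Prop, (∀ v w, G.Adj v w ↔ D v w ∨ D w v) ∧ (∀ v w, D v w → ¬ D w v) ∧
      (∀ v, 2 * {w | D v w}.ncard = degS G v) ∧ ∀ v, 2 * {w | D w v}.ncard = degS G v := by
  classical
  let t : G.edgeSet → Finset (α × Fin 2) := fun e =>
    Finset.univ.filter fun p => p.1 ∈ e.1 ∧ 2 * (p.2 : ℕ) < degS G p.1
  have hall : ∀ s : Finset G.edgeSet, s.card ≤ (s.biUnion t).card := by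
    intro s
    have h1 : 2 * s.card = ∑ v : α, (s.filter fun e => v ∈ e.1).card := by
      have : ∀ e ∈ s, (Finset.univ.filter fun v : α => v ∈ e.1).card = 2 := by
        rintro ⟨e, he⟩ -
        induction e using Sym2.ind with
        | _ a b =>
        have hab : a ≠ b := SimpleGraph.Adj.ne he
        rw [← Finset.card_pair hab]
        congr 1
        ext v; simp
      rw [mul_comm, ← smul_eq_mul, ← Finset.sum_const, ← Finset.sum_congr rfl this]
      simp only [Finset.card_filter]
      rw [Finset.sum_comm]
    have h2 : (s.biUnion t).card = ∑ v : α, ((s.biUnion t).filter fun p => p.1 = v).card :=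
      Finset.card_eq_sum_card_fiberwise (fun _ _ => Finset.mem_univ _)
    have h3 : ∀ v : α, (s.filter fun e => v ∈ e.1).card ≤
        2 * ((s.biUnion t).filter fun p => p.1 = v).card := by
      intro v
      by_cases hv : ∃ e ∈ s, v ∈ e.1
      · obtain ⟨e, he, hve⟩ := hv
        have h4 : (s.filter fun e => v ∈ e.1).card ≤ degS G v := by
          have : degS G v = (G.incidenceFinset v).card := by
            rw [SimpleGraph.card_incidenceFinset_eq_degree, degS_eq_card,
              SimpleGraph.degree, SimpleGraph.neighborFinset_eq_filter]
          rw [this, ← Finset.card_map (Function.Embedding.subtype _)]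
          apply Finset.card_le_card
          intro x hx
          simp only [Finset.mem_map, Finset.mem_filter] at hx
          obtain ⟨y, ⟨-, hy⟩, rfl⟩ := hx
          rw [SimpleGraph.mem_incidenceFinset]
          exact ⟨y.2, hy⟩
        have h5 : ((Finset.univ : Finset (Fin 2)).filter fun i : Fin 2 => 2 * (i : ℕ) < degS G v).card ≤
            ((s.biUnion t).filter fun p => p.1 = v).card := by
          rw [← Finset.card_map (Function.Embedding.sectR v (Fin 2))]
          apply Finset.card_le_card
          intro x hx
          simp only [Finset.mem_map, Finset.mem_filter, Finset.mem_univ, true_and] at hx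
          obtain ⟨i, hi, rfl⟩ := hx
          rw [Finset.mem_filter, Finset.mem_biUnion]
          exact ⟨⟨e, he, Finset.mem_filter.2 ⟨Finset.mem_univ _, hve, hi⟩⟩, rfl⟩
        have h6 : degS G v =
            2 * ((Finset.univ : Finset (Fin 2)).filter fun i : Fin 2 => 2 * (i : ℕ) < degS G v).card :=
          (two_mul_card_filter_fin_two (hEuler v) (hle v)).symm
        omega
      · push Not at hv
        rw [Finset.filter_false_of_mem hv]; simp
    have h4 := Finset.sum_le_sum fun v (_ : v ∈ (Finset.univ : Finset α)) => h3 v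
    rw [← h1, ← Finset.mul_sum, ← h2] at h4
    omega
  obtain ⟨f, hf, hft⟩ := (Finset.all_card_le_biUnion_card_iff_exists_injective t).1 hall
  simp only [t, Finset.mem_filter, Finset.mem_univ, true_and] at hft
  let D : α → α → Prop := fun v w => ∃ h : G.Adj v w, (f ⟨s(v, w), h⟩).1 = v
  have hD : ∀ v w, G.Adj v w ↔ D v w ∨ D w v := by
    intro v w
    constructor
    · intro h
      have := (hft ⟨s(v, w), h⟩).1
      rw [Sym2.mem_iff] at this
      rcases this with h' | h'
      · exact Or.inl ⟨h, h'⟩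
      · refine Or.inr ⟨h.symm, ?_⟩
        have e : (⟨s(w, v), h.symm⟩ : G.edgeSet) = ⟨s(v, w), h⟩ := Subtype.ext Sym2.eq_swap
        rw [e]; exact h'
    · rintro (⟨h, -⟩ | ⟨h, -⟩)
      · exact h
      · exact h.symm
  have hanti : ∀ v w, D v w → ¬ D w v := by
    rintro v w ⟨h, h1⟩ ⟨h', h2⟩
    have : (⟨s(w, v), h'⟩ : G.edgeSet) = ⟨s(v, w), h⟩ := Subtype.ext Sym2.eq_swap
    rw [this, h1] at h2
    exact h.ne h2
  have hsum : ∀ v, {w | D v w}.ncard + {w | D w v}.ncard = degS G v := by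
    intro v
    unfold degS
    rw [← Set.ncard_union_eq]
    · congr 1
      ext w
      exact (hD v w).symm
    · rw [Set.disjoint_left]
      exact fun w h h' => hanti _ _ h h'
  have hout : ∀ v, 2 * {w | D v w}.ncard ≤ degS G v := by
    intro v
    let g : α → Fin 2 := fun w => if h : G.Adj v w then (f ⟨s(v, w), h⟩).2 else 0
    have h6 : 2 * ((Finset.univ : Finset (Fin 2)).filter fun i : Fin 2 => 2 * (i : ℕ) < degS G v).card =
        degS G v :=
      two_mul_card_filter_fin_two (hEuler v) (hle v)
    rw [← h6]
    gcongr
    rw [← Set.ncard_coe_finset]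
    refine Set.ncard_le_ncard_of_injOn g ?_ ?_
    · rintro w ⟨h, hw⟩
      have := (hft ⟨s(v, w), h⟩).2
      rw [hw] at this
      simpa [g, h] using this
    · rintro w ⟨h, hw⟩ w' ⟨h', hw'⟩ hg
      simp only [g, h, h', dif_pos] at hg
      have := congrArg Subtype.val (hf (Prod.ext (hw.trans hw'.symm) hg))
      simp only [Sym2.eq_iff, true_and] at this
      have := h.ne
      grind
  have htot : ∑ v, {w | D v w}.ncard = ∑ v, {w | D w v}.ncard := by
    have h1 : ∀ v, {w | D v w}.ncard = (Finset.univ.filter fun w => D v w).card := fun v => by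
      rw [← Set.ncard_coe_finset]; simp
    have h2 : ∀ v, {w | D w v}.ncard = (Finset.univ.filter fun w => D w v).card := fun v => by
      rw [← Set.ncard_coe_finset]; simp
    simp only [h1, h2, Finset.card_filter]
    exact Finset.sum_comm
  have heq : ∀ v, {w | D v w}.ncard = {w | D w v}.ncard := by
    intro v
    exact (Finset.sum_eq_sum_iff_of_le fun v _ => by
      have := hsum v; have := hout v; omega).1 htot v (Finset.mem_univ _)
  refine ⟨D, hD, hanti, fun v => ?_, fun v => ?_⟩ <;>
  · have := heq v
    have := hsum v
    omega

/-- Petersen: an Eulerian graph of maximum degree at most four splits into two polycycles. -/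
theorem exists_polycycle_decomposition [Fintype α] (G : SimpleGraph α)
    (hEuler : ∀ v, Even (degS G v)) (hle : ∀ v, degS G v ≤ 4) :
    ∃ A ≤ G, IsPolycycle A ∧ IsPolycycle (G \ A) := by
  classical
  obtain ⟨D, hD, hanti, hout, hin⟩ := exists_balanced_orientation G hEuler hle
  have hDne : ∀ v w, D v w → v ≠ w := by rintro v w h rfl; exact hanti _ _ h h
  let c : α → α → ℕ := fun v w => (if D v w then 1 else 0) +
    if v = w then 2 - {w | D v w}.ncard else 0
  have h1 : ∀ v, {w | D v w}.ncard = ∑ w, if D v w then 1 else 0 := fun v => by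
    rw [← Finset.card_filter, ← Set.ncard_coe_finset]; simp
  have h2 : ∀ v, {w | D w v}.ncard = ∑ w, if D w v then 1 else 0 := fun v => by
    rw [← Finset.card_filter, ← Set.ncard_coe_finset]; simp
  have hrow : ∀ v, ∑ w, c v w = 2 := by
    intro v
    simp only [c, Finset.sum_add_distrib]
    rw [← h1, Finset.sum_ite_eq]
    have := hout v
    have := hle v
    simp only [Finset.mem_univ, if_true]
    omega
  have hcol : ∀ w, ∑ v, c v w = 2 := by
    intro w
    simp only [c, Finset.sum_add_distrib]
    rw [← h2, Finset.sum_ite_eq']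
    have := hout w
    have := hin w
    have := hle w
    simp only [Finset.mem_univ, if_true]
    omega
  let t : α → Finset α := fun v => Finset.univ.filter fun w => c v w ≠ 0
  have hall : ∀ s : Finset α, s.card ≤ (s.biUnion t).card := by
    intro s
    have h3 : ∑ v ∈ s, ∑ w ∈ s.biUnion t, c v w = 2 * s.card := by
      rw [mul_comm, ← smul_eq_mul, ← Finset.sum_const]
      refine Finset.sum_congr rfl fun v hv => ?_
      rw [← hrow v]
      refine Finset.sum_subset (Finset.subset_univ _) fun w _ hw => ?_
      by_contra h
      exact hw (Finset.mem_biUnion.2 ⟨v, hv, Finset.mem_filter.2 ⟨Finset.mem_univ _, h⟩⟩)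
    have h4 : ∑ v ∈ s, ∑ w ∈ s.biUnion t, c v w ≤ 2 * (s.biUnion t).card := by
      rw [Finset.sum_comm, mul_comm, ← smul_eq_mul, ← Finset.sum_const]
      refine Finset.sum_le_sum fun w _ => ?_
      rw [← hcol w]
      exact Finset.sum_le_sum_of_subset (Finset.subset_univ _)
    omega
  obtain ⟨σ, hσ, hσt⟩ := (Finset.all_card_le_biUnion_card_iff_exists_injective t).1 hall
  have hσD : ∀ v, σ v ≠ v → D v (σ v) := by
    intro v hv
    have := hσt v
    simp only [t, c, Finset.mem_filter, Finset.mem_univ, true_and, if_neg hv.symm] at this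
    by_contra h
    simp [h] at this
  have hσ4 : ∀ v, degS G v = 4 → σ v ≠ v := by
    intro v hv hvv
    have := hσt v
    simp only [t, c, Finset.mem_filter, Finset.mem_univ, true_and, hvv, if_true] at this
    rw [if_neg fun h => hDne _ _ h rfl] at this
    have := hout v
    omega
  let A : SimpleGraph α :=
    { Adj := fun x y => x ≠ y ∧ (σ x = y ∨ σ y = x)
      symm := ⟨fun x y h => ⟨h.1.symm, h.2.symm⟩⟩
      loopless := ⟨fun x h => h.1 rfl⟩ }
  have hAG : A ≤ G := by
    rintro x y ⟨hne, rfl | rfl⟩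
    · exact (hD _ _).2 (Or.inl (hσD x hne.symm))
    · exact (hD _ _).2 (Or.inr (hσD y hne))
  have hA0 : ∀ v, σ v = v → degS A v = 0 := by
    intro v hv
    rw [degS_eq_zero]
    rintro w ⟨hne, h | h⟩
    · exact hne (hv.symm.trans h)
    · exact hne (hσ (hv.trans h.symm))
  have hA2 : ∀ v, σ v ≠ v → degS A v = 2 := by
    intro v hv
    obtain ⟨u, hu⟩ := (Finite.injective_iff_surjective.1 hσ) v
    have huv : u ≠ v := by rintro rfl; exact hv hu
    rw [degS_eq_two]
    refine ⟨σ v, u, ?_, fun w => ?_⟩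
    · intro h
      have h1 := hσD v hv
      have h2 := hσD u (by rw [hu]; exact huv.symm)
      rw [h] at h1
      rw [hu] at h2
      exact hanti _ _ h1 h2
    · constructor
      · rintro ⟨-, h | h⟩
        · exact Or.inl h.symm
        · exact Or.inr (hσ (h.trans hu.symm))
      · rintro (rfl | rfl)
        · exact ⟨hv.symm, Or.inl rfl⟩
        · exact ⟨huv.symm, Or.inr hu⟩
  refine ⟨A, hAG, fun v => ?_, fun v => ?_⟩
  · by_cases h : σ v = v
    · exact Or.inl (hA0 v h)
    · exact Or.inr (hA2 v h)
  · have hs := degS_sdiff hAG v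
    have hl := hle v
    have h4 := hσ4 v
    obtain ⟨k, hk⟩ := hEuler v
    by_cases h : σ v = v
    · have := hA0 v h
      have : degS G v ≠ 4 := fun h' => h4 h' h
      omega
    · have := hA2 v h
      omega

end Decomposition

section Assembly

variable {α : Type*}

lemma IsMatchingGraph.eq_or_adj_of_reachable {M : SimpleGraph α} (hM : IsMatchingGraph M)
    {a b : α} (h : M.Reachable a b) : b = a ∨ M.Adj a b := by
  refine h.mem_of_closed (P := fun b => b = a ∨ M.Adj a b) ?_ (Or.inl rfl)
  rintro c d (rfl | hc) hcd
  · exact Or.inr hcd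
  · exact Or.inl (hM _ _ _ hcd hc.symm)

lemma IsMatchingGraph.sup_edge {M : SimpleGraph α} (hM : IsMatchingGraph M) {s t : α}
    (hs : ∀ w, ¬ M.Adj s w) (ht : ∀ w, ¬ M.Adj t w) :
    IsMatchingGraph (M ⊔ SimpleGraph.edge s t) := by
  intro a b c hab hac
  rw [SimpleGraph.sup_adj, SimpleGraph.edge_adj] at hab hac
  have := hM a b c
  have := hs b
  have := hs c
  have := ht b
  have := ht c
  grind

lemma isMatchingGraph_edge (s t : α) : IsMatchingGraph (SimpleGraph.edge s t) := by
  intro a b c hab hac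
  rw [SimpleGraph.edge_adj] at hab hac
  grind

lemma edge_le {B : SimpleGraph α} {s t : α} (h : B.Adj s t) : SimpleGraph.edge s t ≤ B := by
  intro a b hab
  rw [SimpleGraph.edge_adj] at hab
  rcases hab with ⟨⟨rfl, rfl⟩ | ⟨rfl, rfl⟩, -⟩
  · exact h
  · exact h.symm

variable [Finite α]

/-- Deleting a matching that has only one edge `ab` in a component of a polycycle leaves a path
from `a` to `b`. -/
lemma IsPolycycle.reachable_sdiff {A M : SimpleGraph α} (hA : IsPolycycle A)
    (hM : IsMatchingGraph M) (hle : M ≤ A) {a b : α} (hab : M.Adj a b)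
    (hu : ∀ c d, M.Adj c d → A.Reachable a c → s(c, d) = s(a, b)) : (A \ M).Reachable a b := by
  obtain ⟨w, hwa, hw, hr, -⟩ := exists_partner _ (A \ M) rfl
    (fun v => (degS_mono sdiff_le v).trans (hA.degS_le v)) a
    ((degS_sdiff_eq_one hA hM hle a).2 (mem_verts.2 ⟨b, hab⟩))
  rw [degS_sdiff_eq_one hA hM hle] at hw
  obtain ⟨d, hd⟩ := mem_verts.1 hw
  have := hu w d hd (hr.mono sdiff_le)
  rw [Sym2.eq_iff] at this
  rcases this with ⟨h, -⟩ | ⟨rfl, -⟩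
  · exact (hwa h).elim
  · exact hr

/-- Two matchings, one in each of two edge-disjoint polycycles, satisfying the requirements for
linking the three path forests they determine. -/
theorem exists_cycles_of_matchings [DecidableEq α] {A B E M : SimpleGraph α}
    (hA : IsPolycycle A) (hB : IsPolycycle B) (hAB : ∀ a b, A.Adj a b → ¬ B.Adj a b)
    (hE : IsTransversal A E) (hMB : M ≤ B) (hM : IsMatchingGraph M)
    (hits : ∀ v w, B.Adj v w → ∃ a b, M.Adj a b ∧ B.Reachable v a)
    (hEM : IsPathForest (E ⊔ M)) (heven : Even (verts E ∩ verts M).card)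
    {v u x p q : α} (hvx : E.Adj v x) (hup : E.Adj u p) (huq : M.Adj u q)
    (huu : ∀ c d, M.Adj c d → B.Reachable u c → s(c, d) = s(u, q)) (hq : q ∉ verts E)
    (hcross : p ∉ verts M ∨ (x ∉ verts M ∧
      (M.Adj v p ∨ ∃ z, M.Adj v z ∧ z ∉ verts E))) :
    ∃ C₁ C₂ C₃ : SimpleGraph α, (C₁ = ⊥ ∨ IsCycleGraph C₁) ∧ (C₂ = ⊥ ∨ IsCycleGraph C₂) ∧
      (C₃ = ⊥ ∨ IsCycleGraph C₃) ∧ symmDiff (symmDiff C₁ C₂) C₃ = A ⊔ B := by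
  have hEm := hE.isMatchingGraph
  have hEMd : ∀ a b, E.Adj a b → ¬ M.Adj a b := fun a b h h' => hAB a b (hE.le h) (hMB h')
  have hqM : q ∈ verts M := mem_verts.2 ⟨u, huq.symm⟩
  have huM : u ∈ verts M := mem_verts.2 ⟨q, huq⟩
  have huE : u ∈ verts E := mem_verts.2 ⟨p, hup⟩
  have hpE : p ∈ verts E := mem_verts.2 ⟨u, hup.symm⟩
  have hvE : v ∈ verts E := mem_verts.2 ⟨x, hvx⟩
  have hxE : x ∈ verts E := mem_verts.2 ⟨v, hvx.symm⟩
  have hF : ∀ a b, E.Adj a b → (A \ E).Reachable a b := fun a b hab =>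
    hA.reachable_sdiff hEm hE.le hab fun c d hcd hr => (hE.unique a b c d hab hcd hr).symm
  have hE3 : ∀ {a b}, E.Adj a b → (E ⊔ M).Adj a b := fun h => Or.inl h
  have hM3 : ∀ {a b}, M.Adj a b → (E ⊔ M).Adj a b := fun h => Or.inr h
  have h₁ : IsLinked (A \ E) (verts E ∩ verts M) (verts E \ verts M) := by
    refine ⟨hA.isPathForest_sdiff hEm hE.le hE.hits, fun w => ?_, ?_, fun _ _ => ?_⟩
    · rw [degS_sdiff_eq_one hA hEm hE.le, Finset.mem_inter, Finset.mem_sdiff]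
      tauto
    · exact Finset.disjoint_left.2 fun a ha ha' =>
        (Finset.mem_sdiff.1 ha').2 (Finset.mem_inter.1 ha).2
    · rcases hcross with hp | ⟨hx, hv⟩
      · exact ⟨u, Finset.mem_inter.2 ⟨huE, huM⟩, p, Finset.mem_sdiff.2 ⟨hpE, hp⟩, hF _ _ hup⟩
      · have hvM : v ∈ verts M := by
          rcases hv with h | ⟨z, h, -⟩ <;> exact mem_verts.2 ⟨_, h⟩
        exact ⟨v, Finset.mem_inter.2 ⟨hvE, hvM⟩, x, Finset.mem_sdiff.2 ⟨hxE, hx⟩, hF _ _ hvx⟩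
  have h₂ : IsLinked (B \ M) (verts E ∩ verts M) (verts M \ verts E) := by
    refine ⟨hB.isPathForest_sdiff hM hMB hits, fun w => ?_, ?_, fun _ _ => ?_⟩
    · rw [degS_sdiff_eq_one hB hM hMB, Finset.mem_inter, Finset.mem_sdiff]
      tauto
    · exact Finset.disjoint_left.2 fun a ha ha' =>
        (Finset.mem_sdiff.1 ha').2 (Finset.mem_inter.1 ha).1
    · exact ⟨u, Finset.mem_inter.2 ⟨huE, huM⟩, q, Finset.mem_sdiff.2 ⟨hqM, hq⟩,
        hB.reachable_sdiff hM hMB huq huu⟩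
  have h₃ : IsLinked (E ⊔ M) (verts E \ verts M) (verts M \ verts E) := by
    refine ⟨hEM, fun w => ?_, ?_, fun _ _ => ?_⟩
    · rw [degS_sup hEMd, Finset.mem_sdiff, Finset.mem_sdiff]
      by_cases h : w ∈ verts E <;> by_cases h' : w ∈ verts M <;>
        simp [h, h', hEm.degS_of_mem, hM.degS_of_mem, degS_of_notMem_verts]
    · exact Finset.disjoint_left.2 fun a ha ha' =>
        (Finset.mem_sdiff.1 ha').2 (Finset.mem_sdiff.1 ha).1
    · have hpq : (E ⊔ M).Reachable p q :=
        (hE3 hup).symm.reachable.trans (hM3 huq).reachable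
      have hxv : (E ⊔ M).Reachable x v := (hE3 hvx).symm.reachable
      rcases hcross with hp | ⟨hx, hv | ⟨z, hz, hzE⟩⟩
      · exact ⟨p, Finset.mem_sdiff.2 ⟨hpE, hp⟩, q, Finset.mem_sdiff.2 ⟨hqM, hq⟩, hpq⟩
      · exact ⟨x, Finset.mem_sdiff.2 ⟨hxE, hx⟩, q, Finset.mem_sdiff.2 ⟨hqM, hq⟩,
          (hxv.trans (hM3 hv).reachable).trans hpq⟩
      · exact ⟨x, Finset.mem_sdiff.2 ⟨hxE, hx⟩, z,
          Finset.mem_sdiff.2 ⟨mem_verts.2 ⟨v, hz.symm⟩, hzE⟩, hxv.trans (hM3 hz).reachable⟩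
  have e₁ := Finset.card_inter_add_card_sdiff (verts E) (verts M)
  have e₂ := Finset.card_inter_add_card_sdiff (verts M) (verts E)
  rw [Finset.inter_comm] at e₂
  have e₃ := hEm.even_card_verts
  have e₄ := hM.even_card_verts
  obtain ⟨C₁, C₂, C₃, c₁, c₂, c₃, hC⟩ := exists_cycles_of_isLinked _ _ _ _ _ _ _ rfl heven
    (by rw [← e₁] at e₃; exact (Nat.even_add.1 e₃).1 heven)
    (by rw [← e₂] at e₄; exact (Nat.even_add.1 e₄).1 heven) h₁ h₂ h₃
  refine ⟨C₁, C₂, C₃, c₁, c₂, c₃, hC.trans ?_⟩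
  ext a b
  simp only [SimpleGraph.symmDiff_adj', SimpleGraph.sdiff_adj, SimpleGraph.sup_adj]
  have i₁ := @hE.le a b
  have i₂ := @hMB a b
  have i₃ := hAB a b
  clear * - i₁ i₂ i₃
  tauto

/-- A matching in a polycycle can be extended by edges in components it misses, so that it meets
all components but one and still forms a path forest with a given matching. -/
lemma exists_greedy_extension {B E M₀ : SimpleGraph α} (hB : IsPolycycle B)
    (hE : IsMatchingGraph E) (v : α) (hM₀ : IsMatchingGraph M₀)
    (hle : M₀ ≤ B) (hF : IsPathForest (E ⊔ M₀)) :
    ∃ M, M₀ ≤ M ∧ M ≤ B ∧ IsMatchingGraph M ∧ IsPathForest (E ⊔ M) ∧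
      (∀ a b, M.Adj a b → M₀.Adj a b ∨
        (¬ B.Reachable a v ∧ ∀ c d, M₀.Adj c d → ¬ B.Reachable a c)) ∧
      ∀ a b, B.Adj a b → ¬ B.Reachable a v → ∃ c d, M.Adj c d ∧ B.Reachable a c := by
  obtain ⟨M, -, hmax⟩ := (Set.toFinite {M : SimpleGraph α | M₀ ≤ M ∧ M ≤ B ∧ IsMatchingGraph M ∧
      IsPathForest (E ⊔ M) ∧ ∀ a b, M.Adj a b → M₀.Adj a b ∨
        (¬ B.Reachable a v ∧ ∀ c d, M₀.Adj c d → ¬ B.Reachable a c)}).exists_le_maximal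
    (a := M₀) ⟨le_rfl, hle, hM₀, hF, fun a b h => Or.inl h⟩
  obtain ⟨h1, h2, h3, h4, h5⟩ := hmax.prop
  refine ⟨M, h1, h2, h3, h4, h5, ?_⟩
  by_contra! hcon
  obtain ⟨z, w, hzw, hzv, hz⟩ := hcon
  obtain ⟨z₁, z₂, h12, hzn⟩ := degS_eq_two.1 (hB.degS_eq_two hzw)
  have hmiss : ∀ t, B.Reachable z t → ∀ d, ¬ M.Adj t d := fun t ht d hd => hz t d hd ht
  have hdeg : ∀ t, B.Reachable z t → degS (E ⊔ M) t ≤ 1 := by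
    intro t ht
    rw [degS_le_one]
    rintro a b (ha | ha) (hb | hb)
    · exact hE _ _ _ ha hb
    · exact (hmiss t ht _ hb).elim
    · exact (hmiss t ht _ ha).elim
    · exact (hmiss t ht _ ha).elim
  have hz₁ : B.Adj z z₁ := (hzn _).2 (Or.inl rfl)
  have hz₂ : B.Adj z z₂ := (hzn _).2 (Or.inr rfl)
  obtain ⟨t, ht, hnr⟩ : ∃ t, B.Adj z t ∧ ¬ (E ⊔ M).Reachable z t := by
    by_contra! hcon
    have r₁ := hcon _ hz₁
    have r₂ := hcon _ hz₂
    obtain ⟨c, hc⟩ := r₁.exists_adj hz₁.ne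
    have hd1 := hdeg z (SimpleGraph.Reachable.refl _)
    have := degS_pos.2 ⟨c, hc⟩
    exact h12 (eq_of_reachable_ends h4.1 (by omega) (hdeg _ hz₁.reachable)
      (hdeg _ hz₂.reachable) hz₁.ne.symm hz₂.ne.symm r₁ r₂)
  have hzz := SimpleGraph.Reachable.refl (G := B) z
  have hnew : ∀ a, B.Reachable z a →
      ¬ B.Reachable a v ∧ ∀ c d, M₀.Adj c d → ¬ B.Reachable a c := fun a ha =>
    ⟨fun h => hzv (ha.trans h), fun c d hcd h => hz c d (h1 hcd) (ha.trans h)⟩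
  have hmem : M ⊔ SimpleGraph.edge z t ∈ {M : SimpleGraph α | M₀ ≤ M ∧ M ≤ B ∧
      IsMatchingGraph M ∧ IsPathForest (E ⊔ M) ∧ ∀ a b, M.Adj a b → M₀.Adj a b ∨
        (¬ B.Reachable a v ∧ ∀ c d, M₀.Adj c d → ¬ B.Reachable a c)} := by
    refine ⟨h1.trans le_sup_left, sup_le h2 (edge_le ht),
      h3.sup_edge (hmiss z hzz) (hmiss t ht.reachable), ?_, ?_⟩
    · rw [← sup_assoc]
      exact h4.sup_edge (hdeg z hzz) (hdeg t ht.reachable) hnr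
    · intro a b hab
      rw [SimpleGraph.sup_adj, SimpleGraph.edge_adj] at hab
      rcases hab with hab | ⟨⟨rfl, rfl⟩ | ⟨rfl, rfl⟩, -⟩
      · exact h5 a b hab
      · exact Or.inr (hnew _ hzz)
      · exact Or.inr (hnew _ ht.reachable)
  have hadj : (M ⊔ SimpleGraph.edge z t).Adj z t := Or.inr ht.ne.edge_adj'
  exact hmiss z hzz t (hmax.le_of_ge hmem le_sup_left hadj)

end Assembly

section Hubs

variable {α : Type*}

/-- A transversal of `A` through two prescribed edges that avoids two prescribed vertices. -/
lemma exists_hub_transversal {A B : SimpleGraph α} (hAB : ∀ a b, A.Adj a b → ¬ B.Adj a b)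
    {v u x p y q : α} (hvx : A.Adj v x) (hvy : B.Adj v y) (hup : A.Adj u p) (huq : B.Adj u q)
    (nA : ¬ A.Reachable v u) (nB : ¬ B.Reachable v u) (hyp : y ≠ p) (hqx : q ≠ x)
    (hR : ∀ a b, A.Adj a b → ¬ A.Reachable a v → ¬ A.Reachable a u → ∃ c d, A.Adj c d ∧
      A.Reachable a c ∧ c ≠ y ∧ c ≠ q ∧ d ≠ y ∧ d ≠ q) :
    ∃ E, IsTransversal A E ∧ E.Adj v x ∧ E.Adj u p ∧ (∀ w, ¬ E.Adj y w) ∧ ∀ w, ¬ E.Adj q w := by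
  have nA' : ¬ A.Reachable u v := fun h => nA h.symm
  obtain ⟨E, hE, hok⟩ := exists_isTransversal A (fun a b =>
    (A.Reachable a v → s(a, b) = s(v, x)) ∧ (A.Reachable a u → s(a, b) = s(u, p)) ∧
    (¬ A.Reachable a v → ¬ A.Reachable a u → a ≠ y ∧ a ≠ q ∧ b ≠ y ∧ b ≠ q)) (by
      intro a b hab
      by_cases h₁ : A.Reachable a v
      · exact ⟨v, x, hvx, h₁, fun _ => rfl, fun h => (nA h).elim,
          fun h => (h (SimpleGraph.Reachable.refl _)).elim⟩
      by_cases h₂ : A.Reachable a u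
      · exact ⟨u, p, hup, h₂, fun h => (nA' h).elim, fun _ => rfl,
          fun _ h => (h (SimpleGraph.Reachable.refl _)).elim⟩
      obtain ⟨c, d, hcd, hr, h⟩ := hR a b hab h₁ h₂
      exact ⟨c, d, hcd, hr, fun h' => (h₁ (hr.trans h')).elim,
        fun h' => (h₂ (hr.trans h')).elim, fun _ _ => ⟨h.1, h.2.1, h.2.2⟩⟩)
  have key : ∀ a b, E.Adj a b → (A.Reachable a v → s(a, b) = s(v, x)) ∧
      (A.Reachable a u → s(a, b) = s(u, p)) ∧
      (¬ A.Reachable a v → ¬ A.Reachable a u → a ≠ y ∧ a ≠ q) := by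
    intro a b hab
    have hr : A.Reachable b a := (hE.le hab).symm.reachable
    rcases hok a b hab with ⟨h₁, h₂, h₃⟩ | ⟨h₁, h₂, h₃⟩
    · exact ⟨h₁, h₂, fun i j => ⟨(h₃ i j).1, (h₃ i j).2.1⟩⟩
    · refine ⟨fun h => Sym2.eq_swap.trans (h₁ (hr.trans h)),
        fun h => Sym2.eq_swap.trans (h₂ (hr.trans h)), fun i j => ?_⟩
      have := h₃ (fun h => i (hr.symm.trans h)) (fun h => j (hr.symm.trans h))
      exact this.2.2
  refine ⟨E, hE, ?_, ?_, fun w hw => ?_, fun w hw => ?_⟩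
  · obtain ⟨a, b, hab, hr⟩ := hE.hits _ _ hvx
    have := (key a b hab).1 hr.symm
    rwa [← SimpleGraph.mem_edgeSet, this, SimpleGraph.mem_edgeSet] at hab
  · obtain ⟨a, b, hab, hr⟩ := hE.hits _ _ hup
    have := (key a b hab).2.1 hr.symm
    rwa [← SimpleGraph.mem_edgeSet, this, SimpleGraph.mem_edgeSet] at hab
  · obtain ⟨h₁, h₂, h₃⟩ := key _ _ hw
    by_cases i : A.Reachable y v
    · rcases Sym2.eq_iff.1 (h₁ i) with ⟨rfl, -⟩ | ⟨rfl, -⟩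
      · exact hvy.ne rfl
      · exact hAB _ _ hvx hvy
    by_cases j : A.Reachable y u
    · rcases Sym2.eq_iff.1 (h₂ j) with ⟨rfl, -⟩ | ⟨rfl, -⟩
      · exact nB hvy.reachable
      · exact hyp rfl
    exact (h₃ i j).1 rfl
  · obtain ⟨h₁, h₂, h₃⟩ := key _ _ hw
    by_cases i : A.Reachable q v
    · rcases Sym2.eq_iff.1 (h₁ i) with ⟨rfl, -⟩ | ⟨rfl, -⟩
      · exact nB huq.symm.reachable
      · exact hqx rfl
    by_cases j : A.Reachable q u
    · rcases Sym2.eq_iff.1 (h₂ j) with ⟨rfl, -⟩ | ⟨rfl, -⟩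
      · exact huq.ne rfl
      · exact hAB _ _ hup huq
    exact (h₃ i j).2 rfl

variable [Finite α]

lemma card_inter_verts_sup_edge [DecidableEq α] (T : Finset α) {M : SimpleGraph α}
    {s t : α} (hst : s ≠ t) (hs : s ∉ verts M) (ht : t ∉ verts M) :
    (T ∩ verts (M ⊔ SimpleGraph.edge s t)).card =
      (T ∩ verts M).card + (if s ∈ T then 1 else 0) + (if t ∈ T then 1 else 0) := by
  have : verts (M ⊔ SimpleGraph.edge s t) = insert s (insert t (verts M)) := by
    ext w
    simp only [mem_verts, SimpleGraph.sup_adj, SimpleGraph.edge_adj, Finset.mem_insert]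
    constructor
    · rintro ⟨b, h | ⟨h, -⟩⟩
      · exact Or.inr (Or.inr ⟨b, h⟩)
      · rcases h with h | h
        exacts [Or.inl h.1, Or.inr (Or.inl h.1)]
    · rintro (rfl | rfl | ⟨b, h⟩)
      · exact ⟨t, Or.inr ⟨Or.inl ⟨rfl, rfl⟩, hst⟩⟩
      · exact ⟨s, Or.inr ⟨Or.inr ⟨rfl, rfl⟩, hst.symm⟩⟩
      · exact ⟨b, Or.inl h⟩
  rw [this]
  by_cases h₁ : s ∈ T <;> by_cases h₂ : t ∈ T <;>
    simp [h₁, h₂, Finset.inter_insert_of_mem, Finset.inter_insert_of_notMem, hs, ht, hst]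

/-- The part of the second matching lying in prescribed components. -/
lemma exists_hub_matching {A B E : SimpleGraph α}
    (hAB : ∀ a b, A.Adj a b → ¬ B.Adj a b) {v u x p q : α} (hvx : A.Adj v x)
    (hup : A.Adj u p) (huq : B.Adj u q) (nA : ¬ A.Reachable v u) (nB : ¬ B.Reachable v u)
    (hqx : q ≠ x)
    (hR : ∀ a b, B.Adj a b → ¬ B.Reachable a v → ¬ B.Reachable a u → ∃ c d, B.Adj c d ∧
      B.Reachable a c ∧ c ≠ x ∧ c ≠ p ∧ d ≠ x ∧ d ≠ p)
    (hf : ∃ z, ∀ w, (w = x ∨ w = p) → B.Reachable v w ∨ B.Reachable u w ∨ B.Reachable z w ∨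
      ∀ t, ¬ B.Adj w t)
    (hE : IsTransversal A E) (hqE : ∀ w, ¬ E.Adj q w) :
    ∃ M ≤ B, IsMatchingGraph M ∧ IsPathForest (E ⊔ M) ∧ M.Adj u q ∧
      (∀ c d, M.Adj c d → B.Reachable u c → s(c, d) = s(u, q)) ∧
      (∀ c d, M.Adj c d → ¬ B.Reachable v c) ∧ (∀ w, ¬ M.Adj x w) ∧ (∀ w, ¬ M.Adj p w) ∧
      ∀ w, (w = x ∨ w = p) → B.Reachable v w ∨ (∃ c d, M.Adj c d ∧ B.Reachable w c) ∨
        ∀ t, ¬ B.Adj w t := by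
  have hEm := hE.isMatchingGraph
  have hxu : x ≠ u := fun h => nA (h ▸ hvx.reachable)
  have hpq : p ≠ q := fun h => hAB _ _ hup (h ▸ huq)
  have hdE : ∀ w, degS E w ≤ 1 := fun w => degS_le_one.2 fun a b => hEm w a b
  have hur : ∀ c d, (SimpleGraph.edge u q).Adj c d → s(c, d) = s(u, q) := by
    intro c d h
    rw [SimpleGraph.edge_adj] at h
    exact Sym2.eq_iff.2 h.1
  have hur' : ∀ c d, (SimpleGraph.edge u q).Adj c d → ¬ B.Reachable v c := by
    intro c d h h'
    rcases Sym2.eq_iff.1 (hur c d h) with ⟨rfl, -⟩ | ⟨rfl, -⟩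
    · exact nB h'
    · exact nB (h'.trans huq.symm.reachable)
  have hux : ∀ w, ¬ (SimpleGraph.edge u q).Adj x w := by
    intro w h
    rcases Sym2.eq_iff.1 (hur _ _ h) with ⟨h, -⟩ | ⟨h, -⟩
    · exact hxu h
    · exact hqx h.symm
  have hup' : ∀ w, ¬ (SimpleGraph.edge u q).Adj p w := by
    intro w h
    rcases Sym2.eq_iff.1 (hur _ _ h) with ⟨h, -⟩ | ⟨h, -⟩
    · exact hup.ne h.symm
    · exact hpq h
  obtain ⟨z, hz⟩ := hf
  by_cases hout : ∃ t, B.Adj z t ∧ ¬ B.Reachable z v ∧ ¬ B.Reachable z u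
  · obtain ⟨t, hzt, hzv, hzu⟩ := hout
    obtain ⟨c, d, hcd, hr, hcx, hcp, hdx, hdp⟩ := hR _ _ hzt hzv hzu
    have hrd : B.Reachable z d := hr.trans hcd.reachable
    have hcu : c ≠ u := fun h => hzu (h ▸ hr)
    have hdu : d ≠ u := fun h => hzu (h ▸ hrd)
    have hcq : c ≠ q := fun h => hzu ((h ▸ hr).trans huq.symm.reachable)
    have hdq : d ≠ q := fun h => hzu ((h ▸ hrd).trans huq.symm.reachable)
    have hce : ∀ a b, (SimpleGraph.edge c d).Adj a b → (a = c ∧ b = d) ∨ (a = d ∧ b = c) := by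
      intro a b h
      rw [SimpleGraph.edge_adj] at h
      exact h.1
    have hcr : ∀ a b, (SimpleGraph.edge c d).Adj a b → B.Reachable z a := by
      intro a b h
      rcases hce a b h with ⟨rfl, -⟩ | ⟨rfl, -⟩ <;> assumption
    refine ⟨SimpleGraph.edge c d ⊔ SimpleGraph.edge u q, sup_le (edge_le hcd) (edge_le huq),
      (isMatchingGraph_edge c d).sup_edge ?_ ?_, ?_, Or.inr huq.ne.edge_adj', ?_, ?_, ?_, ?_, ?_⟩
    · intro w h
      rcases hce _ _ h with h | h
      exacts [hcu h.1.symm, hdu h.1.symm]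
    · intro w h
      rcases hce _ _ h with h | h
      exacts [hcq h.1.symm, hdq h.1.symm]
    · rw [← sup_assoc]
      have hq : ∀ w, ¬ (E ⊔ SimpleGraph.edge c d).Adj q w := by
        rintro w (h | h)
        · exact hqE w h
        · rcases hce _ _ h with h | h
          exacts [hcq h.1.symm, hdq h.1.symm]
      refine (hEm.isPathForest.sup_edge (hdE c) (hdE d) fun h => ?_).sup_edge ?_ ?_ fun h => ?_
      · rcases hEm.eq_or_adj_of_reachable h with h | h
        · exact hcd.ne h.symm
        · exact hAB _ _ (hE.le h) hcd
      · rw [degS_le_one]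
        rintro a b (ha | ha) (hb | hb)
        · exact hEm _ _ _ ha hb
        · rcases hce _ _ hb with h | h
          exacts [(hcu h.1.symm).elim, (hdu h.1.symm).elim]
        all_goals
          rcases hce _ _ ha with h | h
          exacts [(hcu h.1.symm).elim, (hdu h.1.symm).elim]
      · rw [degS_eq_zero.2 hq]
        exact zero_le_one
      · exact huq.ne (h.symm.eq_of_isolated hq)
    · rintro a b (h | h) hr'
      · exact (hzu ((hcr a b h).trans hr'.symm)).elim
      · exact hur a b h
    · rintro a b (h | h) hr'
      · exact hzv ((hcr a b h).trans hr'.symm)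
      · exact hur' a b h hr'
    · rintro w (h | h)
      · rcases hce _ _ h with h | h
        exacts [hcx h.1.symm, hdx h.1.symm]
      · exact hux w h
    · rintro w (h | h)
      · rcases hce _ _ h with h | h
        exacts [hcp h.1.symm, hdp h.1.symm]
      · exact hup' w h
    · intro w hw
      rcases hz w hw with h | h | h | h
      · exact Or.inl h
      · exact Or.inr (Or.inl ⟨u, q, Or.inr huq.ne.edge_adj', h.symm⟩)
      · exact Or.inr (Or.inl ⟨c, d, Or.inl hcd.ne.edge_adj', h.symm.trans hr⟩)
      · exact Or.inr (Or.inr h)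
  · refine ⟨SimpleGraph.edge u q, edge_le huq, isMatchingGraph_edge u q,
      hEm.isPathForest.sup_edge (hdE u) (hdE q) fun h => huq.ne (h.symm.eq_of_isolated hqE),
      huq.ne.edge_adj', fun c d h _ => hur c d h, hur', hux, hup', fun w hw => ?_⟩
    have huw : B.Reachable w u → ∃ c d, (SimpleGraph.edge u q).Adj c d ∧ B.Reachable w c :=
      fun h => ⟨u, q, huq.ne.edge_adj', h⟩
    rcases hz w hw with h | h | h | h
    · exact Or.inl h
    · exact Or.inr (Or.inl (huw h.symm))
    · by_cases hw' : ∃ t, B.Adj w t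
      · obtain ⟨t, ht⟩ := hw'
        have hzt : ∃ t, B.Adj z t := by
          by_cases h' : z = w
          · exact ⟨t, h' ▸ ht⟩
          · exact h.exists_adj h'
        obtain ⟨t', ht'⟩ := hzt
        by_cases hzv : B.Reachable z v
        · exact Or.inl (hzv.symm.trans h)
        by_cases hzu : B.Reachable z u
        · exact Or.inr (Or.inl (huw (h.symm.trans hzu)))
        exact (hout ⟨t', ht', hzv, hzu⟩).elim
      · exact Or.inr (Or.inr (not_exists.1 hw'))
    · exact Or.inr (Or.inr h)

end Hubs

section TwoHubs

variable {α : Type*} [Finite α]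

lemma IsPolycycle.exists_other {A : SimpleGraph α} (hA : IsPolycycle A) {v w : α}
    (h : A.Adj v w) : ∃ w', A.Adj v w' ∧ w ≠ w' := by
  obtain ⟨a, b, hab, hn⟩ := _root_.degS_eq_two.1 (hA.degS_eq_two h)
  rcases (hn w).1 h with rfl | rfl
  · exact ⟨b, (hn b).2 (Or.inr rfl), hab⟩
  · exact ⟨a, (hn a).2 (Or.inl rfl), hab.symm⟩

/-- The choice of the edges of the second matching in the component of a hub. -/
lemma exists_cycles_of_hub_matching [DecidableEq α] {A B E N : SimpleGraph α}
    (hA : IsPolycycle A) (hB : IsPolycycle B) (hAB : ∀ a b, A.Adj a b → ¬ B.Adj a b)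
    (hE : IsTransversal A E) (hNB : N ≤ B) (hN : IsMatchingGraph N)
    (hEN : IsPathForest (E ⊔ N)) {v u x y p q : α} (hvy : B.Adj v y)
    (nA : ¬ A.Reachable v u) (nB : ¬ B.Reachable v u) (hyp : y ≠ p)
    (hvx : E.Adj v x) (hup : E.Adj u p) (huq : N.Adj u q)
    (hyE : ∀ w, ¬ E.Adj y w) (hqE : ∀ w, ¬ E.Adj q w)
    (huu : ∀ c d, N.Adj c d → B.Reachable u c → s(c, d) = s(u, q))
    (hNv : ∀ c d, N.Adj c d → ¬ B.Reachable v c)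
    (hNx : ∀ w, ¬ N.Adj x w) (hNp : ∀ w, ¬ N.Adj p w)
    (hits : ∀ a b, B.Adj a b → ¬ B.Reachable a v → ∃ c d, N.Adj c d ∧ B.Reachable a c) :
    ∃ C₁ C₂ C₃ : SimpleGraph α, (C₁ = ⊥ ∨ IsCycleGraph C₁) ∧ (C₂ = ⊥ ∨ IsCycleGraph C₂) ∧
      (C₃ = ⊥ ∨ IsCycleGraph C₃) ∧ symmDiff (symmDiff C₁ C₂) C₃ = A ⊔ B := by
  have hEm := hE.isMatchingGraph
  have hvp : p ≠ v := fun h => nA (h ▸ (hE.le hup).symm.reachable)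
  have hxp : x ≠ p := fun h => nA ((hE.le hvx).reachable.trans (h ▸ (hE.le hup).symm.reachable))
  have hNv' : ∀ w, B.Reachable v w → w ∉ verts N := fun w hw h => by
    obtain ⟨d, hd⟩ := mem_verts.1 h
    exact hNv w d hd hw
  have hxN : x ∉ verts N := fun h => (mem_verts.1 h).elim hNx
  have hpN : p ∉ verts N := fun h => (mem_verts.1 h).elim hNp
  have hvT : v ∈ verts E := mem_verts.2 ⟨x, hvx⟩
  have hpT : p ∈ verts E := mem_verts.2 ⟨u, hup.symm⟩
  have hyT : y ∉ verts E := fun h => (mem_verts.1 h).elim hyE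
  have hqT : q ∉ verts E := fun h => (mem_verts.1 h).elim hqE
  have hdeg : ∀ w, B.Reachable v w → degS (E ⊔ N) w ≤ 1 := by
    intro w hw
    rw [degS_le_one]
    rintro a b (ha | ha) (hb | hb)
    · exact hEm _ _ _ ha hb
    · exact (hNv _ _ hb hw).elim
    · exact (hNv _ _ ha hw).elim
    · exact (hNv _ _ ha hw).elim
  have hiso : ∀ w, B.Reachable v w → w ∉ verts E → ∀ t, ¬ (E ⊔ N).Adj w t := by
    rintro w hw hwT t (h | h)
    · exact hwT (mem_verts.2 ⟨t, h⟩)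
    · exact hNv _ _ h hw
  have hxy : x ≠ y := fun h => hAB _ _ (hE.le hvx) (h ▸ hvy)
  have rv := SimpleGraph.Reachable.refl (G := B) v
  have ry : B.Reachable v y := hvy.reachable
  have mem : ∀ (M : SimpleGraph α) {s t w : α}, w ∉ verts M → w ≠ s → w ≠ t →
      w ∉ verts (M ⊔ SimpleGraph.edge s t) := by
    intro M s t w h₁ h₂ h₃ h
    obtain ⟨d, h | h⟩ := mem_verts.1 h
    · exact h₁ (mem_verts.2 ⟨d, h⟩)
    · rw [SimpleGraph.edge_adj] at h
      rcases h.1 with h | h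
      exacts [h₂ h.1, h₃ h.1]
  have finish : ∀ M : SimpleGraph α, N ≤ M → M ≤ B → IsMatchingGraph M →
      (∀ c d, M.Adj c d → N.Adj c d ∨ B.Reachable v c) → (∃ c d, M.Adj c d ∧ B.Reachable v c) →
      IsPathForest (E ⊔ M) → Even (verts E ∩ verts M).card →
      (p ∉ verts M ∨ (x ∉ verts M ∧ (M.Adj v p ∨ ∃ z, M.Adj v z ∧ z ∉ verts E))) →
      ∃ C₁ C₂ C₃ : SimpleGraph α, (C₁ = ⊥ ∨ IsCycleGraph C₁) ∧ (C₂ = ⊥ ∨ IsCycleGraph C₂) ∧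
        (C₃ = ⊥ ∨ IsCycleGraph C₃) ∧ symmDiff (symmDiff C₁ C₂) C₃ = A ⊔ B := by
    intro M hNM hMB hM hMN hMv hF heven hcross
    refine exists_cycles_of_matchings hA hB hAB hE hMB hM (fun a b hab => ?_) hF heven hvx hup
      (hNM huq) (fun c d hcd hr => ?_) hqT hcross
    · by_cases h : B.Reachable a v
      · obtain ⟨c, d, hcd, hr⟩ := hMv
        exact ⟨c, d, hcd, h.trans hr⟩
      · obtain ⟨c, d, hcd, hr⟩ := hits a b hab h
        exact ⟨c, d, hNM hcd, hr⟩
    · rcases hMN c d hcd with h | h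
      · exact huu c d h hr
      · exact (nB (h.trans hr.symm)).elim
  have single : ∀ s t, B.Adj s t → B.Reachable v s → ¬ (E ⊔ N).Reachable s t →
      Even (verts E ∩ verts (N ⊔ SimpleGraph.edge s t)).card →
      (p ∉ verts (N ⊔ SimpleGraph.edge s t) ∨ (x ∉ verts (N ⊔ SimpleGraph.edge s t) ∧
        ((N ⊔ SimpleGraph.edge s t).Adj v p ∨
          ∃ z, (N ⊔ SimpleGraph.edge s t).Adj v z ∧ z ∉ verts E))) →
      ∃ C₁ C₂ C₃ : SimpleGraph α, (C₁ = ⊥ ∨ IsCycleGraph C₁) ∧ (C₂ = ⊥ ∨ IsCycleGraph C₂) ∧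
        (C₃ = ⊥ ∨ IsCycleGraph C₃) ∧ symmDiff (symmDiff C₁ C₂) C₃ = A ⊔ B := by
    intro s t hst hs hnr
    have ht := hs.trans hst.reachable
    refine finish _ le_sup_left (sup_le hNB (edge_le hst))
      (hN.sup_edge (fun w h => hNv _ _ h hs) (fun w h => hNv _ _ h ht)) ?_
      ⟨s, t, Or.inr hst.ne.edge_adj', hs⟩ ?_
    · rintro c d (h | h)
      · exact Or.inl h
      · rw [SimpleGraph.edge_adj] at h
        rcases h.1 with ⟨rfl, -⟩ | ⟨rfl, -⟩
        exacts [Or.inr hs, Or.inr ht]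
    · rw [← sup_assoc]
      exact hEN.sup_edge (hdeg _ hs) (hdeg _ ht) hnr
  by_cases hpar : Even (verts E ∩ verts N).card
  swap
  · refine single v y hvy rv (fun h => hvy.ne (h.symm.eq_of_isolated (hiso _ ry hyT))) ?_
      (Or.inl (mem _ hpN hvp hyp.symm))
    rw [card_inter_verts_sup_edge _ hvy.ne (hNv' _ rv) (hNv' _ ry)]
    simpa [hvT, hyT, Nat.even_add_one] using hpar
  obtain ⟨y', hvy', hyy'⟩ := hB.exists_other hvy
  obtain ⟨y₂, hyy₂, hvy₂⟩ := hB.exists_other hvy.symm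
  have ry' : B.Reachable v y' := hvy'.reachable
  have ry₂ : B.Reachable v y₂ := ry.trans hyy₂.reachable
  have hxy' : x ≠ y' := fun h => hAB _ _ (hE.le hvx) (h ▸ hvy')
  by_cases hy'T : y' ∈ verts E
  · refine single v y' hvy' rv (fun h => ?_) ?_ ?_
    · have : y' = v ∨ y' = x := by
        refine h.mem_of_closed (P := fun b => b = v ∨ b = x) ?_ (Or.inl rfl)
        rintro c d (rfl | rfl) (hcd | hcd)
        · exact Or.inr (hEm _ _ _ hcd hvx)
        · exact (hNv _ _ hcd rv).elim
        · exact Or.inl (hEm _ _ _ hcd hvx.symm)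
        · exact (hNx _ hcd).elim
      rcases this with h | h
      exacts [hvy'.ne h.symm, hxy' h.symm]
    · rw [card_inter_verts_sup_edge _ hvy'.ne (hNv' _ rv) (hNv' _ ry')]
      simpa [hvT, hy'T, Nat.even_add_one] using hpar
    · by_cases hpy' : p = y'
      · exact Or.inr ⟨mem _ hxN hvx.ne.symm hxy', by
        subst hpy'
        exact Or.inl (Or.inr hvy'.ne.edge_adj')⟩
      · exact Or.inl (mem _ hpN hvp hpy')
  by_cases hy₂T : y₂ ∈ verts E
  swap
  · refine single y y₂ hyy₂ ry (fun h => hyy₂.ne (h.eq_of_isolated (hiso _ ry hyT)).symm) ?_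
      (Or.inl (mem _ hpN hyp.symm fun h => hy₂T (h ▸ hpT)))
    rw [card_inter_verts_sup_edge _ hyy₂.ne (hNv' _ ry) (hNv' _ ry₂)]
    simpa [hyT, hy₂T] using hpar
  have hy'₂ : y₂ ≠ y' := fun h => hy'T (h ▸ hy₂T)
  have hpy' : p ≠ y' := fun h => hy'T (h ▸ hpT)
  have hyM : y ∉ verts (N ⊔ SimpleGraph.edge v y') := mem _ (hNv' _ ry) hvy.ne.symm hyy'
  have hy₂M : y₂ ∉ verts (N ⊔ SimpleGraph.edge v y') := mem _ (hNv' _ ry₂) hvy₂.symm hy'₂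
  have hadj : ∀ M : SimpleGraph α, (M ⊔ SimpleGraph.edge v y').Adj v y' :=
    fun M => Or.inr hvy'.ne.edge_adj'
  refine finish (N ⊔ SimpleGraph.edge v y' ⊔ SimpleGraph.edge y y₂)
    (le_sup_left.trans le_sup_left) (sup_le (sup_le hNB (edge_le hvy')) (edge_le hyy₂))
    ((hN.sup_edge (fun w h => hNv _ _ h rv) (fun w h => hNv _ _ h ry')).sup_edge
      (fun w h => hyM (mem_verts.2 ⟨w, h⟩)) (fun w h => hy₂M (mem_verts.2 ⟨w, h⟩))) ?_
    ⟨v, y', Or.inl (hadj _), rv⟩ ?_ ?_ ?_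
  · rintro c d ((h | h) | h)
    · exact Or.inl h
    · rw [SimpleGraph.edge_adj] at h
      rcases h.1 with ⟨rfl, -⟩ | ⟨rfl, -⟩
      exacts [Or.inr rv, Or.inr ry']
    · rw [SimpleGraph.edge_adj] at h
      rcases h.1 with ⟨rfl, -⟩ | ⟨rfl, -⟩
      exacts [Or.inr ry, Or.inr ry₂]
  · rw [← sup_assoc, ← sup_assoc]
    have hyF : ∀ w, ¬ (E ⊔ N ⊔ SimpleGraph.edge v y').Adj y w := by
      rintro w (h | h)
      · exact hiso _ ry hyT w h
      · exact hyM (mem_verts.2 ⟨w, Or.inr h⟩)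
    refine (hEN.sup_edge (hdeg _ rv) (hdeg _ ry') fun h =>
      hvy'.ne (h.symm.eq_of_isolated (hiso _ ry' hy'T))).sup_edge ?_ ?_ fun h =>
        hyy₂.ne (h.eq_of_isolated hyF).symm
    · rw [degS_eq_zero.2 hyF]
      exact zero_le_one
    · rw [degS_le_one]
      have hE' : ∀ a, (E ⊔ N ⊔ SimpleGraph.edge v y').Adj y₂ a → E.Adj y₂ a := by
        rintro a ((h | h) | h)
        · exact h
        · exact (hNv _ _ h ry₂).elim
        · exact (hy₂M (mem_verts.2 ⟨a, Or.inr h⟩)).elim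
      exact fun a b ha hb => hEm _ _ _ (hE' a ha) (hE' b hb)
  · rw [card_inter_verts_sup_edge _ hyy₂.ne hyM hy₂M,
      card_inter_verts_sup_edge _ hvy'.ne (hNv' _ rv) (hNv' _ ry')]
    simpa [hvT, hyT, hy'T, hy₂T, Nat.even_add_one] using hpar
  · by_cases hpy₂ : p = y₂
    · exact Or.inr ⟨mem _ (mem _ hxN hvx.ne.symm hxy') hxy (hpy₂ ▸ hxp),
        Or.inr ⟨y', Or.inl (hadj _), hy'T⟩⟩
    · exact Or.inl (mem _ (mem _ hpN hvp hpy') hyp.symm hpy₂)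

/-- The cycles obtained from two hubs, each joined to prescribed neighbors. -/
theorem exists_cycles_of_hubs {A B : SimpleGraph α} (hA : IsPolycycle A) (hB : IsPolycycle B)
    (hAB : ∀ a b, A.Adj a b → ¬ B.Adj a b) {v u x y p q : α}
    (hvx : A.Adj v x) (hvy : B.Adj v y) (hup : A.Adj u p) (huq : B.Adj u q)
    (nA : ¬ A.Reachable v u) (nB : ¬ B.Reachable v u) (hyp : y ≠ p) (hqx : q ≠ x)
    (hR : ∀ a b, A.Adj a b → ¬ A.Reachable a v → ¬ A.Reachable a u → ∃ c d, A.Adj c d ∧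
      A.Reachable a c ∧ c ≠ y ∧ c ≠ q ∧ d ≠ y ∧ d ≠ q)
    (hR' : ∀ a b, B.Adj a b → ¬ B.Reachable a v → ¬ B.Reachable a u → ∃ c d, B.Adj c d ∧
      B.Reachable a c ∧ c ≠ x ∧ c ≠ p ∧ d ≠ x ∧ d ≠ p)
    (hf : ∃ z, ∀ w, (w = x ∨ w = p) → B.Reachable v w ∨ B.Reachable u w ∨ B.Reachable z w ∨
      ∀ t, ¬ B.Adj w t) :
    ∃ C₁ C₂ C₃ : SimpleGraph α, (C₁ = ⊥ ∨ IsCycleGraph C₁) ∧ (C₂ = ⊥ ∨ IsCycleGraph C₂) ∧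
      (C₃ = ⊥ ∨ IsCycleGraph C₃) ∧ symmDiff (symmDiff C₁ C₂) C₃ = A ⊔ B := by
  classical
  obtain ⟨E, hE, hEvx, hEup, hyE, hqE⟩ :=
    exists_hub_transversal hAB hvx hvy hup huq nA nB hyp hqx hR
  obtain ⟨M, hMB, hM, hF, huqM, hMu, hMv, hMx, hMp, hcov⟩ :=
    exists_hub_matching hAB hvx hup huq nA nB hqx hR' hf hE hqE
  obtain ⟨N, hMN, hNB, hN, hEN, hNM, hits⟩ :=
    exists_greedy_extension hB hE.isMatchingGraph v hM hMB hF
  have avoid : ∀ w, (w = x ∨ w = p) → (∀ t, ¬ M.Adj w t) → ∀ t, ¬ N.Adj w t := by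
    intro w hw hwM t h
    rcases hNM w t h with h' | ⟨h₁, h₂⟩
    · exact hwM t h'
    · rcases hcov w hw with h' | ⟨c, d, hcd, hr⟩ | h'
      · exact h₁ h'.symm
      · exact h₂ c d hcd hr
      · exact h' t (hNB h)
  refine exists_cycles_of_hub_matching hA hB hAB hE hNB hN hEN hvy nA nB hyp hEvx hEup
    (hMN huqM) hyE hqE (fun c d hcd hr => ?_) (fun c d hcd hr => ?_)
    (avoid x (Or.inl rfl) hMx) (avoid p (Or.inr rfl) hMp) hits
  · rcases hNM c d hcd with h | ⟨-, h⟩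
    · exact hMu c d h hr
    · exact (h u q huqM hr.symm).elim
  · rcases hNM c d hcd with h | ⟨h, -⟩
    · exact hMv c d h hr
    · exact h hr.symm

end TwoHubs

section Selection

variable {α : Type*}

/-- `G` is a symmetric difference of at most three cycles. -/
def IsSumOfThreeCycles (G : SimpleGraph α) : Prop :=
  ∃ C₁ C₂ C₃ : SimpleGraph α, (C₁ = ⊥ ∨ IsCycleGraph C₁) ∧ (C₂ = ⊥ ∨ IsCycleGraph C₂) ∧
    (C₃ = ⊥ ∨ IsCycleGraph C₃) ∧ symmDiff (symmDiff C₁ C₂) C₃ = G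

/-- Every nontrivial component of `A` other than those of `v` and `u` has an edge containing
neither `y` nor `q`. -/
def CanAvoid (A : SimpleGraph α) (v u y q : α) : Prop :=
  ∀ a b, A.Adj a b → ¬ A.Reachable a v → ¬ A.Reachable a u → ∃ c d, A.Adj c d ∧
    A.Reachable a c ∧ c ≠ y ∧ c ≠ q ∧ d ≠ y ∧ d ≠ q

/-- A vertex that is isolated neither in `A` nor in `B`. -/
def IsHub (A B : SimpleGraph α) (w : α) : Prop := (∃ t, A.Adj w t) ∧ ∃ t, B.Adj w t

/-- The component of `v`, as a graph without edges elsewhere. -/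
def componentGraph (A : SimpleGraph α) (v : α) : SimpleGraph α where
  Adj a b := A.Adj a b ∧ A.Reachable v a
  symm := ⟨fun _ _ h => ⟨h.1.symm, h.2.trans h.1.reachable⟩⟩
  loopless := ⟨fun _ h => h.1.ne rfl⟩

lemma CanAvoid.symm {A : SimpleGraph α} {v u y q : α} (h : CanAvoid A v u y q) :
    CanAvoid A v u q y := by
  intro a b hab hv hu
  obtain ⟨c, d, hcd, hr, h₁, h₂, h₃, h₄⟩ := h a b hab hv hu
  exact ⟨c, d, hcd, hr, h₂, h₁, h₄, h₃⟩

lemma componentGraph_le (A : SimpleGraph α) (v : α) : componentGraph A v ≤ A := fun _ _ h => h.1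

lemma degS_componentGraph_of_reachable {A : SimpleGraph α} {v w : α} (h : A.Reachable v w) :
    degS (componentGraph A v) w = degS A w := by
  have : (componentGraph A v).neighborSet w = A.neighborSet w := by
    ext t
    exact ⟨fun ht => ht.1, fun ht => ⟨ht, h⟩⟩
  rw [degS, this, degS]

variable [Finite α]

lemma IsPolycycle.exists_edge_avoiding {A : SimpleGraph α} (hA : IsPolycycle A) {a b : α}
    (h : A.Adj a b) (y : α) : ∃ c d, A.Adj c d ∧ A.Reachable a c ∧ c ≠ y ∧ d ≠ y := by
  by_cases hay : a = y
  · obtain ⟨b', hb', hne⟩ := hA.exists_other h.symm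
    exact ⟨b, b', hb', h.reachable, hay ▸ h.ne.symm, hay ▸ hne.symm⟩
  by_cases hby : b = y
  · obtain ⟨b', hb', hne⟩ := hA.exists_other h
    exact ⟨a, b', hb', SimpleGraph.Reachable.refl _, hay, hby ▸ hne.symm⟩
  · exact ⟨a, b, h, SimpleGraph.Reachable.refl _, hay, hby⟩

lemma IsPolycycle.canAvoid {A : SimpleGraph α} (hA : IsPolycycle A) {v u q : α}
    (hq : A.Reachable v q ∨ A.Reachable u q) (y : α) : CanAvoid A v u y q := by
  intro a b hab hv hu
  have hr : ∀ c, A.Reachable a c → c ≠ q := by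
    rintro c hc rfl
    rcases hq with h | h
    · exact hv (hc.trans h.symm)
    · exact hu (hc.trans h.symm)
  obtain ⟨c, d, hcd, hac, hc, hd⟩ := hA.exists_edge_avoiding hab y
  exact ⟨c, d, hcd, hac, hc, hr c hac, hd, hr d (hac.trans hcd.reachable)⟩

lemma IsPolycycle.of_not_canAvoid {A : SimpleGraph α} (hA : IsPolycycle A) {v u y q : α}
    (h : ¬ CanAvoid A v u y q) : A.Reachable y q ∧ ¬ A.Reachable y v ∧
      ∀ c d, A.Adj c d → A.Reachable y c → c = y ∨ c = q ∨ d = y ∨ d = q := by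
  unfold CanAvoid at h
  push Not at h
  obtain ⟨a, b, hab, hv, -, h⟩ := h
  have key : ∀ c d, A.Adj c d → A.Reachable a c → c = y ∨ c = q ∨ d = y ∨ d = q := by
    intro c d hcd hac
    by_contra! hcon
    exact hcon.2.2.2 (h c d hcd hac hcon.1 hcon.2.1 hcon.2.2.1)
  have hy : A.Reachable a y := by
    obtain ⟨c, d, hcd, hac, hc, hd⟩ := hA.exists_edge_avoiding hab q
    rcases key c d hcd hac with rfl | h | rfl | h
    · exact hac
    · exact (hc h).elim
    · exact hac.trans hcd.reachable
    · exact (hd h).elim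
  have hq : A.Reachable a q := by
    obtain ⟨c, d, hcd, hac, hc, hd⟩ := hA.exists_edge_avoiding hab y
    rcases key c d hcd hac with h | rfl | h | rfl
    · exact (hc h).elim
    · exact hac
    · exact (hd h).elim
    · exact hac.trans hcd.reachable
  exact ⟨hy.symm.trans hq, fun h' => hv (hy.trans h'),
    fun c d hcd hr => key c d hcd (hy.trans hr)⟩

lemma IsPolycycle.adj_of_not_canAvoid {A : SimpleGraph α} (hA : IsPolycycle A) {v u y q y' : α}
    (h : ¬ CanAvoid A v u y q) (hr : A.Reachable y y') (hy : y' ≠ y) (hq : y' ≠ q) :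
    A.Adj y' y ∧ A.Adj y' q := by
  obtain ⟨-, -, key⟩ := hA.of_not_canAvoid h
  obtain ⟨c, hc⟩ := hr.symm.exists_adj hy
  obtain ⟨d, hd, hcd⟩ := hA.exists_other hc
  have h₁ := key y' c hc hr
  have h₂ := key y' d hd hr
  grind

lemma IsPolycycle.exists_canAvoid {A : SimpleGraph α} (hA : IsPolycycle A) {v u y y' q q' : α}
    (hy : y ≠ y') (hq : q ≠ q') (h₁ : y ≠ q) (h₂ : y' ≠ q) (h₃ : y' ≠ q') :
    ∃ Y Q, (Y = y ∨ Y = y') ∧ (Q = q ∨ Q = q') ∧ CanAvoid A v u Y Q := by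
  by_contra! hcon
  have f₁ := hcon y q (Or.inl rfl) (Or.inl rfl)
  have f₂ := hcon y q' (Or.inl rfl) (Or.inr rfl)
  have f₃ := hcon y' q (Or.inr rfl) (Or.inl rfl)
  have hr : A.Reachable y y' := (hA.of_not_canAvoid f₁).1.trans (hA.of_not_canAvoid f₃).1.symm
  have := (hA.of_not_canAvoid f₂).2.2 y' q (hA.adj_of_not_canAvoid f₁ hr hy.symm h₂).2 hr
  grind

/-- Two independent hubs with a common neighbor. -/
lemma isSumOfThreeCycles_of_common_neighbor {A B : SimpleGraph α} (hA : IsPolycycle A)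
    (hB : IsPolycycle B) (hAB : ∀ a b, A.Adj a b → ¬ B.Adj a b) {v u w : α}
    (hv : IsHub A B v) (hu : IsHub A B u) (hvw : B.Adj v w) (hwu : A.Adj w u)
    (nA : ¬ A.Reachable v u) (nB : ¬ B.Reachable v u) : IsSumOfThreeCycles (A ⊔ B) := by
  have hBA : ∀ a b, B.Adj a b → ¬ A.Adj a b := fun a b h h' => hAB a b h' h
  obtain ⟨⟨x, hx⟩, -⟩ := hv
  obtain ⟨-, q, hq⟩ := hu
  obtain ⟨x', hx', hxx'⟩ := hA.exists_other hx
  obtain ⟨q', hq', hqq'⟩ := hB.exists_other hq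
  obtain ⟨p, hp, hwp⟩ := hA.exists_other hwu.symm
  have main : ∀ X, A.Adj v X → CanAvoid B v u X p → IsSumOfThreeCycles (A ⊔ B) := by
    intro X hX hav
    obtain ⟨Q, hQ, hXQ⟩ : ∃ Q, B.Adj u Q ∧ X ≠ Q := by
      by_cases h : X = q
      · exact ⟨q', hq', h ▸ hqq'⟩
      · exact ⟨q, hq, h⟩
    rw [sup_comm]
    refine exists_cycles_of_hubs hB hA hBA hvw hX hQ hp nB nA hXQ hwp.symm hav
      (hA.canAvoid (Or.inr hwu.symm.reachable) Q).symm ⟨Q, ?_⟩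
    rintro t (rfl | rfl)
    · exact Or.inr (Or.inl hwu.symm.reachable)
    · exact Or.inr (Or.inr (Or.inl (SimpleGraph.Reachable.refl _)))
  by_cases c₁ : CanAvoid B v u x p
  · exact main x hx c₁
  by_cases c₂ : CanAvoid B v u x' p
  · exact main x' hx' c₂
  have hr : B.Reachable x x' := (hB.of_not_canAvoid c₁).1.trans (hB.of_not_canAvoid c₂).1.symm
  have hxx : B.Adj x' x := (hB.adj_of_not_canAvoid c₁ hr hxx'.symm fun h =>
    nA (hx'.reachable.trans (h ▸ hp.symm.reachable))).1
  obtain ⟨m, hm, hvm⟩ := hB.exists_other hvw.symm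
  have hrw : B.Reachable w v := hvw.symm.reachable
  refine exists_cycles_of_hubs hA hB hAB hwu hm hx.symm hxx.symm
    (fun h => nA (hx.reachable.trans (h.symm.trans hwu.reachable)))
    (fun h => (hB.of_not_canAvoid c₁).2.1 (h.symm.trans hrw)) hvm.symm
    (fun h => nA (h ▸ hx'.reachable))
    (hA.canAvoid (Or.inr (hx.symm.reachable.trans hx'.reachable)) m)
    (hB.canAvoid (Or.inl hrw) u) ⟨u, ?_⟩
  rintro t (rfl | rfl)
  · exact Or.inr (Or.inr (Or.inl (SimpleGraph.Reachable.refl _)))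
  · exact Or.inl hrw

/-- Two independent hubs. -/
lemma isSumOfThreeCycles_of_independent {A B : SimpleGraph α} (hA : IsPolycycle A)
    (hB : IsPolycycle B) (hAB : ∀ a b, A.Adj a b → ¬ B.Adj a b) {v u : α}
    (hv : IsHub A B v) (hu : IsHub A B u)
    (nA : ¬ A.Reachable v u) (nB : ¬ B.Reachable v u) : IsSumOfThreeCycles (A ⊔ B) := by
  by_contra hcon
  have hBA : ∀ a b, B.Adj a b → ¬ A.Adj a b := fun a b h h' => hAB a b h' h
  have common : ∀ {a b c : α}, IsHub A B a → IsHub A B b → B.Adj a c → A.Adj c b →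
      ¬ A.Reachable a b → B.Reachable a b := by
    intro a b c ha hb hac hcb h
    by_contra h'
    exact hcon (isSumOfThreeCycles_of_common_neighbor hA hB hAB ha hb hac hcb h h')
  have select : ∀ {F H : SimpleGraph α}, IsPolycycle F → IsPolycycle H → (∃ t, H.Adj v t) →
      (∃ t, H.Adj u t) → ¬ H.Reachable v u →
      ∃ y q, H.Adj v y ∧ H.Adj u q ∧ CanAvoid F v u y q := by
    rintro F H hF hH ⟨y, hy⟩ ⟨q, hq⟩ hn
    obtain ⟨y', hy', hyy⟩ := hH.exists_other hy
    obtain ⟨q', hq', hqq⟩ := hH.exists_other hq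
    have ne : ∀ {a b}, H.Adj v a → H.Adj u b → a ≠ b := fun ha hb h =>
      hn (ha.reachable.trans (h ▸ hb.symm.reachable))
    obtain ⟨Y, Q, hY, hQ, h⟩ := hF.exists_canAvoid (v := v) (u := u) hyy hqq (ne hy hq)
      (ne hy' hq) (ne hy' hq')
    refine ⟨Y, Q, ?_, ?_, h⟩
    · rcases hY with rfl | rfl <;> assumption
    · rcases hQ with rfl | rfl <;> assumption
  obtain ⟨y, q, hy, hq, hR⟩ := select hA hB hv.2 hu.2 nB
  obtain ⟨x, p, hx, hp, hR'⟩ := select hB hA hv.1 hu.1 nA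
  have hyp : y ≠ p := fun h => nB (common hv hu hy (h ▸ hp.symm) nA)
  have hqx : q ≠ x := fun h =>
    nB (common hu hv hq (h ▸ hx.symm) fun h => nA h.symm).symm
  have hx' : ¬ (B.Reachable v x ∨ ∀ t, ¬ B.Adj x t) := by
    intro h
    refine hcon (exists_cycles_of_hubs hA hB hAB hx hy hp hq nA nB hyp hqx hR hR' ⟨p, ?_⟩)
    rintro t (rfl | rfl)
    · tauto
    · exact Or.inr (Or.inr (Or.inl (SimpleGraph.Reachable.refl _)))
  have hy' : ¬ (A.Reachable v y ∨ ∀ t, ¬ A.Adj y t) := by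
    intro h
    rw [sup_comm] at hcon
    refine hcon (exists_cycles_of_hubs hB hA hBA hy hx hq hp nB nA hqx.symm hyp.symm hR' hR
      ⟨q, ?_⟩)
    rintro t (rfl | rfl)
    · tauto
    · exact Or.inr (Or.inr (Or.inl (SimpleGraph.Reachable.refl _)))
  push Not at hx' hy'
  exact hx'.1 (hy.reachable.trans (common ⟨hy'.2, v, hy.symm⟩ ⟨⟨v, hx.symm⟩, hx'.2⟩ hy.symm hx
    fun h => hy'.1 (hx.reachable.trans h.symm)))

lemma degS_componentGraph_of_not_reachable {A : SimpleGraph α} {v w : α}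
    (h : ¬ A.Reachable v w) : degS (componentGraph A v) w = 0 :=
  degS_eq_zero.2 fun _ ht => h ht.2

lemma IsPolycycle.isCycleGraph_componentGraph {A : SimpleGraph α} (hA : IsPolycycle A) {v t : α}
    (h : A.Adj v t) : IsCycleGraph (componentGraph A v) := by
  have hadj : (componentGraph A v).Adj v t := ⟨h, SimpleGraph.Reachable.refl _⟩
  have hr : ∀ w, A.Reachable v w → (componentGraph A v).Reachable v w := by
    intro w hw
    refine (hw.mem_of_closed (P := fun w => A.Reachable v w ∧
      (componentGraph A v).Reachable v w) ?_ ⟨SimpleGraph.Reachable.refl _,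
        SimpleGraph.Reachable.refl _⟩).2
    rintro a b ⟨h₁, h₂⟩ hab
    exact ⟨h₁.trans hab.reachable,
      h₂.trans (SimpleGraph.Adj.reachable (G := componentGraph A v) ⟨hab, h₁⟩)⟩
  refine ⟨fun h' => ?_, fun w => ?_, fun a b ha hb => ?_⟩
  · rw [h'] at hadj
    exact hadj
  · by_cases hw : A.Reachable v w
    · rw [degS_componentGraph_of_reachable hw]
      exact hA w
    · exact Or.inl (degS_componentGraph_of_not_reachable hw)
  · obtain ⟨c, hc⟩ := degS_pos.1 ha
    obtain ⟨d, hd⟩ := degS_pos.1 hb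
    exact (hr _ hc.2).symm.trans (hr _ hd.2)

/-- All hubs lie in one component of one of the two polycycles. -/
lemma isSumOfThreeCycles_of_component {A B : SimpleGraph α} (hA : IsPolycycle A)
    (hB : IsPolycycle B) (hAB : ∀ a b, A.Adj a b → ¬ B.Adj a b) {v : α}
    (hv : IsHub A B v) (h : ∀ w, IsHub A B w → A.Reachable v w) :
    IsSumOfThreeCycles (A ⊔ B) := by
  have hle : componentGraph A v ≤ A ⊔ B := (componentGraph_le A v).trans le_sup_left
  have hP : IsPolycycle ((A ⊔ B) \ componentGraph A v) := by
    intro w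
    have e := degS_sdiff hle w
    rw [degS_sup hAB] at e
    have a := hA w
    have b := hB w
    by_cases hw : A.Reachable v w
    · rw [degS_componentGraph_of_reachable hw] at e
      omega
    · rw [degS_componentGraph_of_not_reachable hw] at e
      have : degS A w = 0 ∨ degS B w = 0 := by
        by_contra! hcon
        exact hw (h w ⟨degS_pos.1 (Nat.pos_of_ne_zero hcon.1),
          degS_pos.1 (Nat.pos_of_ne_zero hcon.2)⟩)
      omega
  obtain ⟨C₁, C₂, h₁, h₂, hC⟩ := hP.exists_two_cycles
  obtain ⟨t, ht⟩ := hv.1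
  refine ⟨C₁, C₂, componentGraph A v, h₁, h₂, Or.inr (hA.isCycleGraph_componentGraph ht), ?_⟩
  rw [hC, symmDiff_eq_sup_sdiff_inf]
  simp [sdiff_sup_cancel hle]

/-- Two edge-disjoint polycycles with a common vertex. -/
theorem isSumOfThreeCycles_sup {A B : SimpleGraph α} (hA : IsPolycycle A)
    (hB : IsPolycycle B) (hAB : ∀ a b, A.Adj a b → ¬ B.Adj a b) {v : α} (hv : IsHub A B v) :
    IsSumOfThreeCycles (A ⊔ B) := by
  by_cases hind : ∃ a b, IsHub A B a ∧ IsHub A B b ∧ ¬ A.Reachable a b ∧ ¬ B.Reachable a b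
  · obtain ⟨a, b, ha, hb, nA, nB⟩ := hind
    exact isSumOfThreeCycles_of_independent hA hB hAB ha hb nA nB
  push Not at hind
  by_cases hall : ∀ w, IsHub A B w → A.Reachable v w
  · exact isSumOfThreeCycles_of_component hA hB hAB hv hall
  by_cases hall' : ∀ w, IsHub A B w → B.Reachable v w
  · rw [sup_comm]
    exact isSumOfThreeCycles_of_component hB hA (fun a b h h' => hAB a b h' h) hv.symm
      fun w hw => hall' w hw.symm
  push Not at hall hall'
  obtain ⟨b, hb, hvb⟩ := hall
  obtain ⟨d, hd, hvd⟩ := hall'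
  have hvbB := hind v b hv hb hvb
  have hvdA : A.Reachable v d := by_contra fun h => hvd (hind v d hv hd h)
  exact (hvd (hvbB.trans (hind b d hb hd fun h => hvb (hvdA.trans h.symm)))).elim

end Selection

/-- Every Eulerian graph of maximum degree 4 admits a cycle odd-cover of size at
most 3. -/
theorem eulerian_maxDegree_four_cycle_oddCover_three
    {α : Type*} [Fintype α] (G : SimpleGraph α)
    (hEuler : ∀ v, Even (degS G v))
    (hle : ∀ v, degS G v ≤ 4) (hmax : ∃ v, degS G v = 4) :
    ∃ L : List (SimpleGraph α), L.length ≤ 3 ∧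
      (∀ C ∈ L, IsCycleGraph C) ∧ listSymmDiff L = G := by
  obtain ⟨A, hAG, hA, hB⟩ := exists_polycycle_decomposition G hEuler hle
  obtain ⟨v, hv⟩ := hmax
  have hadd := degS_sdiff hAG v
  have hAv := hA.degS_le v
  have hBv := hB.degS_le v
  obtain ⟨C₁, C₂, C₃, h₁, h₂, h₃, h⟩ := isSumOfThreeCycles_sup hA hB
    (fun a b h h' => ((SimpleGraph.sdiff_adj _ _ _ _).1 h').2 h)
    (v := v) ⟨degS_pos.1 (by omega), degS_pos.1 (by omega)⟩
  rw [sup_sdiff_cancel_right hAG] at h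
  exact exists_list_of_cycles h₁ h₂ h₃ h
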